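/- arXiv:2302.10841 — 2 statements merged into one kernel-verified Lean document; each statement's English description precedes it below -/
import Mathlib

section
/- Let β=∞, let G=[n]² be the n×n grid, and let A={(i,i) : i∈[n]} be the diagonal, pinned to −1. Starting from the configuration that is +1 on V∖A, the A-corrupted Glauber dynamics reaches the identically −1 configuration in expected time O(n⁵): there is a universal constant C such that E[inf{t : X̃_t ≡ −1}] ≤ C·n⁵. -/
open Real Finset
open scoped Classical

noncomputable section

/-- The `n × n` grid graph on `[n]² = Fin n × Fin n`. -/
def grid (n : ℕ) : SimpleGraph (Fin n × Fin n) :=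
  SimpleGraph.fromRel (fun p q =>
    (p.1 = q.1 ∧ p.2.val + 1 = q.2.val) ∨ (p.2 = q.2 ∧ p.1.val + 1 = q.1.val))

variable {V : Type*} [Fintype V] [DecidableEq V]

/-- The real value of a spin: `true ↦ +1`, `false ↦ -1`. -/
def spinVal (b : Bool) : ℝ := if b then 1 else -1

/-- Sum of the spins of the neighbors of `v`. -/
def nbrSum (G : SimpleGraph V) (σ : V → Bool) (v : V) : ℝ :=
  ∑ u : V, if G.Adj v u then spinVal (σ u) else 0

/-- Zero-temperature (`β = ∞`) Glauber probability of updating `v` to `+1`: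
`1` if the neighboring spin sum is positive, `1/2` if it is zero, `0` if negative. -/
def zeroTempP (G : SimpleGraph V) (σ : V → Bool) (v : V) : ℝ :=
  if 0 < nbrSum G σ v then 1 else if nbrSum G σ v = 0 then 1/2 else 0

/-- One-step kernel of the zero-temperature `A`-corrupted Glauber dynamics with `A`
pinned to spin `s`. -/
def pinnedK0 (G : SimpleGraph V) (A : Finset V) (s : Bool) (σ σ' : V → Bool) : ℝ :=
  (Fintype.card V : ℝ)⁻¹ * ∑ v : V,
    if v ∈ A then (if σ' = Function.update σ v s then 1 else 0)
    else (if σ' = Function.update σ v true then zeroTempP G σ v else 0)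
       + (if σ' = Function.update σ v false then 1 - zeroTempP G σ v else 0)

/-- Probability of a trajectory `h` of length `t+1` of the Markov chain with kernel `K`
started at `σ₀`. -/
def trajMC (σ₀ : V → Bool) (K : (V → Bool) → (V → Bool) → ℝ) :
    (t : ℕ) → (Fin (t+1) → (V → Bool)) → ℝ
  | 0, h => if h 0 = σ₀ then 1 else 0
  | t+1, h => trajMC σ₀ K t (fun i => h i.castSucc) *
      K (h (Fin.last t).castSucc) (h (Fin.last (t+1)))

/-- Probability that the chain has not visited the configuration `bad` by time `t`. -/
def survProb (σ₀ : V → Bool) (K : (V → Bool) → (V → Bool) → ℝ)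
    (bad : V → Bool) (t : ℕ) : ℝ :=
  ∑ h : Fin (t+1) → (V → Bool),
    if (∀ i, h i ≠ bad) then trajMC σ₀ K t h else 0

/-- Expected hitting time of the configuration `bad`:
`E[τ] = ∑_{t ≥ 0} P(τ > t)`. -/
def expHitTime (σ₀ : V → Bool) (K : (V → Bool) → (V → Bool) → ℝ)
    (bad : V → Bool) : ℝ :=
  ∑' t : ℕ, survProb σ₀ K bad t

/-- The diagonal `{(i,i) : i ∈ [n]}` of the grid. -/
def diag (n : ℕ) : Finset (Fin n × Fin n) := univ.filter (fun p => p.1 = p.2)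


section chain
variable {W : Type*} [Fintype W] [DecidableEq W]

lemma survM_step (σ₀ : W → Bool) (K : (W → Bool) → (W → Bool) → ℝ) (bad : W → Bool)
    (F : (W → Bool) → ℝ) (δ : ℝ)
    (hK : ∀ σ σ', 0 ≤ K σ σ') (hF : ∀ σ, 0 ≤ F σ)
    (hd : ∀ σ, σ ≠ bad → ∑ x, K σ x * F x ≤ F σ - δ) (t : ℕ) :
    (∑ h : Fin (t+1+1) → (W → Bool),
      if (∀ i, h i ≠ bad) then trajMC σ₀ K (t+1) h * F (h (Fin.last (t+1))) else 0)
    ≤ (∑ h : Fin (t+1) → (W → Bool),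
      if (∀ i, h i ≠ bad) then trajMC σ₀ K t h * F (h (Fin.last t)) else 0)
      - δ * survProb σ₀ K bad t := by
  have htr : ∀ (t : ℕ) (h : Fin (t+1) → (W → Bool)), 0 ≤ trajMC σ₀ K t h := by
    intro t
    induction t with
    | zero => intro h; simp only [trajMC]; split_ifs <;> norm_num
    | succ t ih => intro h; simp only [trajMC]; exact mul_nonneg (ih _) (hK _ _)
  rw [← (Fin.snocEquiv (fun _ : Fin (t+1+1) => (W → Bool))).sum_comp, Fintype.sum_prod_type_right]
  unfold survProb
  rw [Finset.mul_sum, ← Finset.sum_sub_distrib]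
  refine Finset.sum_le_sum fun h _ => ?_
  by_cases hb : ∀ i, h i ≠ bad
  · rw [if_pos hb, if_pos hb]
    calc _ ≤ ∑ x, trajMC σ₀ K t h * (K (h (Fin.last t)) x * F x) := by
          refine Finset.sum_le_sum fun x _ => ?_
          have e1 : trajMC σ₀ K (t+1) (Fin.snocEquiv (fun _ : Fin (t+1+1) => (W → Bool)) (x, h))
             = trajMC σ₀ K t h * K (h (Fin.last t)) x := by
            simp [trajMC, Fin.snocEquiv]
          have e2 : (Fin.snocEquiv (fun _ : Fin (t+1+1) => (W → Bool)) (x, h)) (Fin.last (t+1)) = x := by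
            simp [Fin.snocEquiv]
          rw [e1, e2]
          have := mul_nonneg (htr t h) (mul_nonneg (hK (h (Fin.last t)) x) (hF x))
          split_ifs
          · exact le_of_eq (by ring)
          · exact this
      _ = trajMC σ₀ K t h * ∑ x, K (h (Fin.last t)) x * F x := by rw [Finset.mul_sum]
      _ ≤ trajMC σ₀ K t h * (F (h (Fin.last t)) - δ) :=
          mul_le_mul_of_nonneg_left (hd _ (hb _)) (htr t h)
      _ = _ := by ring
  · rw [if_neg hb, if_neg hb]
    simp only [mul_zero, sub_zero]
    refine Finset.sum_nonpos fun x _ => ?_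
    rw [if_neg]
    intro hh
    apply hb
    intro i
    have := hh i.castSucc
    simpa [Fin.snocEquiv] using this

lemma expHit_le (σ₀ : W → Bool) (K : (W → Bool) → (W → Bool) → ℝ) (bad : W → Bool)
    (F : (W → Bool) → ℝ) (δ : ℝ) (hδ : 0 < δ)
    (hK : ∀ σ σ', 0 ≤ K σ σ') (hF : ∀ σ, 0 ≤ F σ)
    (hd : ∀ σ, σ ≠ bad → ∑ x, K σ x * F x ≤ F σ - δ) :
    expHitTime σ₀ K bad ≤ F σ₀ / δ := by
  have htr : ∀ (t : ℕ) (h : Fin (t+1) → (W → Bool)), 0 ≤ trajMC σ₀ K t h := by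
    intro t
    induction t with
    | zero => intro h; simp only [trajMC]; split_ifs <;> norm_num
    | succ t ih => intro h; simp only [trajMC]; exact mul_nonneg (ih _) (hK _ _)
  set M : ℕ → ℝ := fun t => ∑ h : Fin (t+1) → (W → Bool),
      if (∀ i, h i ≠ bad) then trajMC σ₀ K t h * F (h (Fin.last t)) else 0 with hM
  have hM0 : M 0 ≤ F σ₀ := by
    have : M 0 ≤ ∑ h : Fin 1 → (W → Bool), if h = (fun _ => σ₀) then F σ₀ else 0 := by
      refine Finset.sum_le_sum fun h _ => ?_
      by_cases h0 : h 0 = σ₀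
      · have : h = fun _ => σ₀ := by
          funext i; rw [Subsingleton.elim (α := Fin 1) i 0]; exact h0
        rw [if_pos this]
        subst this
        have := hF σ₀
        simp only [trajMC]
        split_ifs <;> simp_all
      · have h1 : h ≠ fun _ => σ₀ := by rintro rfl; exact h0 rfl
        rw [if_neg h1]
        simp [trajMC, h0]
    simpa using this
  have hMn : ∀ t, 0 ≤ M t := by
    intro t
    refine Finset.sum_nonneg fun h _ => ?_
    split_ifs
    · exact mul_nonneg (htr _ _) (hF _)
    · exact le_rfl
  have key : ∀ T, δ * ∑ t ∈ Finset.range T, survProb σ₀ K bad t + M T ≤ F σ₀ := by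
    intro T
    induction T with
    | zero => simpa using hM0
    | succ T ih =>
      have := survM_step σ₀ K bad F δ hK hF hd T
      rw [Finset.sum_range_succ, mul_add]
      have h2 : M (T+1) ≤ M T - δ * survProb σ₀ K bad T := this
      linarith
  have hs : ∀ t, 0 ≤ survProb σ₀ K bad t := by
    intro t
    refine Finset.sum_nonneg fun h _ => ?_
    split_ifs
    · exact htr _ _
    · exact le_rfl
  unfold expHitTime
  refine Real.tsum_le_of_sum_range_le hs fun T => ?_
  rw [le_div_iff₀ hδ]
  have := key T
  have := hMn T
  linarith

lemma zeroTempP_nonneg (G : SimpleGraph W) (σ : W → Bool) (v : W) : 0 ≤ zeroTempP G σ v := by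
  unfold zeroTempP; split_ifs <;> norm_num

lemma zeroTempP_le (G : SimpleGraph W) (σ : W → Bool) (v : W) : zeroTempP G σ v ≤ 1 := by
  unfold zeroTempP; split_ifs <;> norm_num

lemma pinnedK0_nonneg (G : SimpleGraph W) (A : Finset W) (s : Bool) (σ σ' : W → Bool) :
    0 ≤ pinnedK0 G A s σ σ' := by
  unfold pinnedK0
  refine mul_nonneg (by positivity) (Finset.sum_nonneg fun v _ => ?_)
  have h1 := zeroTempP_nonneg G σ v
  have h2 := zeroTempP_le G σ v
  split_ifs <;> linarith

/-- Mean of `F` after updating `v`. -/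
def updMean (G : SimpleGraph W) (A : Finset W) (F : (W → Bool) → ℝ) (σ : W → Bool) (v : W) : ℝ :=
  if v ∈ A then F (Function.update σ v false)
  else zeroTempP G σ v * F (Function.update σ v true)
    + (1 - zeroTempP G σ v) * F (Function.update σ v false)

lemma pinnedK0_mean (G : SimpleGraph W) (A : Finset W) (F : (W → Bool) → ℝ) (σ : W → Bool) :
    ∑ x, pinnedK0 G A false σ x * F x = (Fintype.card W : ℝ)⁻¹ * ∑ v, updMean G A F σ v := by
  unfold pinnedK0
  simp only [mul_assoc]
  rw [← Finset.mul_sum]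
  congr 1
  simp only [Finset.sum_mul]
  rw [Finset.sum_comm]
  refine Finset.sum_congr rfl fun v _ => ?_
  unfold updMean
  by_cases hv : v ∈ A
  · simp [hv]
  · simp only [hv, if_false, add_mul, ite_mul, zero_mul, Finset.sum_add_distrib,
      Finset.sum_ite_eq', Finset.mem_univ, if_true]

end chain

section gridpart

/-- Signed spin of the (unique) neighbor satisfying `P`. -/
def dirSum {n : ℕ} (σ : Fin n × Fin n → Bool) (P : Fin n × Fin n → Prop) : ℝ :=
  ∑ u, if P u then spinVal (σ u) else 0

lemma dirSum_cases {n : ℕ} (σ : Fin n × Fin n → Bool) (P : Fin n × Fin n → Prop)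
    (hP : ∀ u w, P u → P w → u = w) :
    (∃ u, P u ∧ dirSum σ P = spinVal (σ u)) ∨ ((∀ u, ¬ P u) ∧ dirSum σ P = 0) := by
  by_cases h : ∃ u, P u
  · left
    obtain ⟨u, hu⟩ := h
    refine ⟨u, hu, ?_⟩
    unfold dirSum
    rw [Finset.sum_eq_single u]
    · simp [hu]
    · intro b _ hb
      rw [if_neg]
      intro hPb
      exact hb (hP _ _ hPb hu)
    · simp
  · right
    push Not at h
    exact ⟨h, by simp [dirSum, h]⟩

lemma nbrSum_eq {n : ℕ} (σ : Fin n × Fin n → Bool) (v : Fin n × Fin n) :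
    nbrSum (grid n) σ v =
      dirSum σ (fun u => u.1.val = v.1.val + 1 ∧ u.2.val = v.2.val) +
      dirSum σ (fun u => u.1.val = v.1.val ∧ u.2.val + 1 = v.2.val) +
      dirSum σ (fun u => u.1.val + 1 = v.1.val ∧ u.2.val = v.2.val) +
      dirSum σ (fun u => u.1.val = v.1.val ∧ u.2.val = v.2.val + 1) := by
  unfold nbrSum dirSum
  rw [← Finset.sum_add_distrib, ← Finset.sum_add_distrib, ← Finset.sum_add_distrib]
  refine Finset.sum_congr rfl fun u _ => ?_
  obtain ⟨a, b⟩ := u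
  obtain ⟨c, d⟩ := v
  have hadj : (grid n).Adj (c, d) (a, b) ↔
      ((a.val = c.val + 1 ∧ b.val = d.val) ∨ (a.val = c.val ∧ b.val + 1 = d.val) ∨
      (a.val + 1 = c.val ∧ b.val = d.val) ∨ (a.val = c.val ∧ b.val = d.val + 1)) := by
    simp only [grid, SimpleGraph.fromRel_adj, ne_eq, Prod.mk.injEq, Fin.ext_iff]
    omega
  simp only [hadj]
  split_ifs <;> first | omega | simp

lemma zeroTempP_key {n : ℕ} (σ : Fin n × Fin n → Bool) (v a b : Fin n × Fin n)
    (ha : a.1.val = v.1.val + 1 ∧ a.2.val = v.2.val)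
    (hb : b.1.val = v.1.val ∧ b.2.val + 1 = v.2.val)
    (hσa : σ a = false) (hσb : σ b = false) :
    zeroTempP (grid n) σ v ≤ 1/2 ∧
    (zeroTempP (grid n) σ v ≠ 0 →
      (∃ x : Fin n × Fin n, (x.1.val + 1 = v.1.val ∧ x.2.val = v.2.val) ∧ σ x = true) ∧
      (∃ x : Fin n × Fin n, (x.1.val = v.1.val ∧ x.2.val = v.2.val + 1) ∧ σ x = true)) := by
  have e := nbrSum_eq σ v
  have h1 := dirSum_cases σ (fun u => u.1.val = v.1.val + 1 ∧ u.2.val = v.2.val)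
    (by rintro ⟨u1, u2⟩ ⟨w1, w2⟩ hu hw; simp only [Prod.mk.injEq, Fin.ext_iff] at *; omega)
  have h2 := dirSum_cases σ (fun u => u.1.val = v.1.val ∧ u.2.val + 1 = v.2.val)
    (by rintro ⟨u1, u2⟩ ⟨w1, w2⟩ hu hw; simp only [Prod.mk.injEq, Fin.ext_iff] at *; omega)
  have h3 := dirSum_cases σ (fun u => u.1.val + 1 = v.1.val ∧ u.2.val = v.2.val)
    (by rintro ⟨u1, u2⟩ ⟨w1, w2⟩ hu hw; simp only [Prod.mk.injEq, Fin.ext_iff] at *; omega)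
  have h4 := dirSum_cases σ (fun u => u.1.val = v.1.val ∧ u.2.val = v.2.val + 1)
    (by rintro ⟨u1, u2⟩ ⟨w1, w2⟩ hu hw; simp only [Prod.mk.injEq, Fin.ext_iff] at *; omega)
  have h1' : dirSum σ (fun u => u.1.val = v.1.val + 1 ∧ u.2.val = v.2.val) = -1 := by
    rcases h1 with ⟨u, hu, h⟩ | ⟨h, _⟩
    · have : u = a := by
        ext <;> omega
      rw [h, this, hσa]; simp [spinVal]
    · exact absurd ha (h a)
  have h2' : dirSum σ (fun u => u.1.val = v.1.val ∧ u.2.val + 1 = v.2.val) = -1 := by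
    rcases h2 with ⟨u, hu, h⟩ | ⟨h, _⟩
    · have : u = b := by
        ext <;> omega
      rw [h, this, hσb]; simp [spinVal]
    · exact absurd hb (h b)
  rw [h1', h2'] at e
  have aux : ∀ P : Fin n × Fin n → Prop,
      ((∃ u, P u ∧ dirSum σ P = spinVal (σ u)) ∨ ((∀ u, ¬ P u) ∧ dirSum σ P = 0)) →
      (dirSum σ P = 1 ∧ ∃ x, P x ∧ σ x = true) ∨ dirSum σ P ≤ 0 := by
    rintro P (⟨u, hu, h⟩ | ⟨_, h⟩)
    · cases hs : σ u
      · right; rw [h, hs]; simp [spinVal]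
      · left; exact ⟨by rw [h, hs]; simp [spinVal], u, hu, hs⟩
    · right; exact h.le
  unfold zeroTempP
  rcases aux _ h3 with ⟨e3, h3⟩ | e3 <;> rcases aux _ h4 with ⟨e4, h4⟩ | e4
  · have : nbrSum (grid n) σ v = 0 := by rw [e, e3, e4]; norm_num
    rw [this]
    norm_num
    exact ⟨by simpa using h3, by simpa using h4⟩
  all_goals
    have : nbrSum (grid n) σ v < 0 := by rw [e]; linarith
    rw [if_neg (by linarith), if_neg (by linarith)]
    norm_num

/-- Upward closure (in the upper triangle) of the plus sites. -/
def upU {n : ℕ} (σ : Fin n × Fin n → Bool) : Finset (Fin n × Fin n) :=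
  univ.filter fun v => ∃ w : Fin n × Fin n,
    v.1.val ≤ w.1.val ∧ w.1.val ≤ w.2.val ∧ w.2.val ≤ v.2.val ∧ σ w = true

lemma mem_upU {n : ℕ} (σ : Fin n × Fin n → Bool) (v : Fin n × Fin n) :
    v ∈ upU σ ↔ ∃ w : Fin n × Fin n,
    v.1.val ≤ w.1.val ∧ w.1.val ≤ w.2.val ∧ w.2.val ≤ v.2.val ∧ σ w = true := by
  simp [upU]

lemma upU_le {n : ℕ} {σ : Fin n × Fin n → Bool} {v : Fin n × Fin n} (h : v ∈ upU σ) :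
    v.1.val ≤ v.2.val := by
  obtain ⟨w, h1, h2, h3, _⟩ := (mem_upU _ _).1 h
  omega

lemma upU_mono {n : ℕ} {σ : Fin n × Fin n → Bool} {v w : Fin n × Fin n} (h : v ∈ upU σ)
    (h1 : w.1.val ≤ v.1.val) (h2 : v.2.val ≤ w.2.val) : w ∈ upU σ := by
  obtain ⟨x, a, b, c, d⟩ := (mem_upU _ _).1 h
  exact (mem_upU _ _).2 ⟨x, by omega, b, by omega, d⟩

/-- Removable sites. -/
def remU {n : ℕ} (σ : Fin n × Fin n → Bool) : Finset (Fin n × Fin n) :=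
  univ.filter fun v => v ∈ upU σ ∧
    ∀ w ∈ upU σ, v.1.val ≤ w.1.val → w.2.val ≤ v.2.val → w = v

/-- Addable sites. -/
def addU {n : ℕ} (σ : Fin n × Fin n → Bool) : Finset (Fin n × Fin n) :=
  univ.filter fun v => v ∉ upU σ ∧
    (∃ x ∈ upU σ, x.1.val + 1 = v.1.val ∧ x.2.val = v.2.val) ∧
    (∃ x ∈ upU σ, x.1.val = v.1.val ∧ x.2.val = v.2.val + 1)

lemma row_rem {n : ℕ} (σ : Fin n × Fin n → Bool) (v : Fin n × Fin n) (hv : v ∈ upU σ)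
    (hn : ∀ w ∈ upU σ, w.2.val ≤ v.2.val → w.1.val ≤ v.1.val) :
    ∃ r ∈ remU σ, r.1.val = v.1.val := by
  have hne : ((upU σ).filter fun w => w.1 = v.1).Nonempty := ⟨v, by simp [hv]⟩
  obtain ⟨r, hr, hmin⟩ := Finset.exists_min_image _ (fun w => w.2.val) hne
  simp only [Finset.mem_filter] at hr hmin
  have hrv := hmin v ⟨hv, rfl⟩
  refine ⟨r, ?_, by rw [hr.2]⟩
  simp only [remU, Finset.mem_filter, Finset.mem_univ, true_and]
  refine ⟨hr.1, fun w hw h1 h2 => ?_⟩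
  have h3 := hn w hw (by omega)
  have h4 : r.1.val = v.1.val := by rw [hr.2]
  have h5 : w.1 = v.1 := by ext; omega
  have h6 := hmin w ⟨hw, h5⟩
  ext <;> omega

lemma count_lt {n : ℕ} (σ : Fin n × Fin n → Bool) (hne : (upU σ).Nonempty) :
    (addU σ).card + 1 ≤ (remU σ).card := by
  obtain ⟨m, hm, hmax⟩ := Finset.exists_max_image (upU σ) (fun w => w.1.val) hne
  have hinj : Set.InjOn (fun v : Fin n × Fin n => v.1.val) (addU σ : Set (Fin n × Fin n)) := by
    intro v hv w hw hvw
    simp only [addU, Finset.coe_filter, Finset.mem_univ, true_and, Set.mem_ofPred_eq] at hv hw hvw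
    obtain ⟨hv1, -, x, hx, hx1, hx2⟩ := hv
    obtain ⟨hw1, -, y, hy, hy1, hy2⟩ := hw
    have h1 : ¬ (x.2.val ≤ w.2.val) := fun h => hw1 (upU_mono hx (by omega) h)
    have h2 : ¬ (y.2.val ≤ v.2.val) := fun h => hv1 (upU_mono hy (by omega) h)
    ext <;> omega
  have hc : ((addU σ).image fun v => v.1.val).card = (addU σ).card :=
    Finset.card_image_of_injOn hinj
  have hnot : m.1.val + 1 ∉ (addU σ).image fun v => v.1.val := by
    intro h
    obtain ⟨v, hv, hvm⟩ := Finset.mem_image.1 h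
    simp only [addU, Finset.mem_filter, Finset.mem_univ, true_and] at hv
    obtain ⟨hv1, -, x, hx, hx1, hx2⟩ := hv
    have := hmax x hx
    omega
  rw [← hc, ← Finset.card_insert_of_notMem hnot]
  refine le_trans (Finset.card_le_card (t := (remU σ).image fun v => v.1.val + 1) ?_)
    Finset.card_image_le
  intro k hk
  rw [Finset.mem_insert] at hk
  rw [Finset.mem_image]
  rcases hk with rfl | hk
  · obtain ⟨r, hr, h⟩ := row_rem σ m hm (fun w hw _ => hmax w hw)
    exact ⟨r, hr, by omega⟩
  · obtain ⟨v, hv, hvm⟩ := Finset.mem_image.1 hk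
    simp only [addU, Finset.mem_filter, Finset.mem_univ, true_and] at hv
    obtain ⟨hv1, ⟨x, hx, hx1, hx2⟩, -⟩ := hv
    obtain ⟨r, hr, h⟩ := row_rem σ x hx (fun w hw hh => by
      by_contra hlt
      exact hv1 (upU_mono hw (by omega) (by omega)))
    exact ⟨r, hr, by omega⟩

lemma upU_update_false {n : ℕ} (σ : Fin n × Fin n → Bool) (v : Fin n × Fin n) :
    upU (Function.update σ v false) ⊆ upU σ := by
  intro w hw
  obtain ⟨x, a, b, c, d⟩ := (mem_upU _ _).1 hw
  refine (mem_upU _ _).2 ⟨x, a, b, c, ?_⟩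
  by_cases hx : x = v
  · subst hx; simp at d
  · simpa [Function.update_of_ne hx] using d

lemma upU_update_false_rem {n : ℕ} (σ : Fin n × Fin n → Bool) (v : Fin n × Fin n)
    (hv : v ∈ remU σ) : (upU (Function.update σ v false)).card + 1 ≤ (upU σ).card := by
  simp only [remU, Finset.mem_filter, Finset.mem_univ, true_and] at hv
  refine Finset.card_lt_card ⟨upU_update_false σ v, fun h => ?_⟩
  obtain ⟨x, a, b, c, d⟩ := (mem_upU _ _).1 (h hv.1)
  by_cases hx : x = v
  · subst hx; simp at d
  · rw [Function.update_of_ne hx] at d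
    exact hx (hv.2 x ((mem_upU _ _).2 ⟨x, le_rfl, b, le_rfl, d⟩) a c)

lemma upU_update_true {n : ℕ} (σ : Fin n × Fin n → Bool) (v : Fin n × Fin n)
    (hv : v ∈ upU σ ∨ ¬ v.1.val ≤ v.2.val) : upU (Function.update σ v true) ⊆ upU σ := by
  intro w hw
  obtain ⟨x, a, b, c, d⟩ := (mem_upU _ _).1 hw
  by_cases hx : x = v
  · subst hx
    rcases hv with hv | hv
    · exact upU_mono hv a c
    · exact absurd b hv
  · rw [Function.update_of_ne hx] at d
    exact (mem_upU _ _).2 ⟨x, a, b, c, d⟩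

lemma upU_update_true_add {n : ℕ} (σ : Fin n × Fin n → Bool) (v : Fin n × Fin n)
    (hv : v ∈ addU σ) : (upU (Function.update σ v true)).card ≤ (upU σ).card + 1 := by
  simp only [addU, Finset.mem_filter, Finset.mem_univ, true_and] at hv
  obtain ⟨hv1, ⟨x, hx, hx1, hx2⟩, y, hy, hy1, hy2⟩ := hv
  refine le_trans (Finset.card_le_card (t := insert v (upU σ)) ?_) (Finset.card_insert_le _ _)
  intro w hw
  rw [Finset.mem_insert]
  obtain ⟨z, a, b, c, d⟩ := (mem_upU _ _).1 hw
  by_cases hz : z = v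
  · subst hz
    by_cases h1 : w.1.val < z.1.val
    · right; exact upU_mono hx (by omega) (by omega)
    by_cases h2 : z.2.val < w.2.val
    · right; exact upU_mono hy (by omega) (by omega)
    left; ext <;> omega
  · rw [Function.update_of_ne hz] at d
    exact Or.inr ((mem_upU _ _).2 ⟨z, a, b, c, d⟩)

/-- The size of the closure. -/
def FU {n : ℕ} (σ : Fin n × Fin n → Bool) : ℝ := ((upU σ).card : ℝ)

lemma not_upU_false {n : ℕ} {σ : Fin n × Fin n → Bool} {v : Fin n × Fin n}
    (h : v ∉ upU σ) (hle : v.1.val ≤ v.2.val) : σ v = false := by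
  by_contra hc
  exact h ((mem_upU _ _).2 ⟨v, le_rfl, hle, le_rfl, by simpa using hc⟩)

lemma updMean_le {n : ℕ} (σ : Fin n × Fin n → Bool) (v : Fin n × Fin n) :
    updMean (grid n) (diag n) FU σ v ≤ FU σ
      + ((if v ∈ addU σ then 1/2 else 0) - (if v ∈ remU σ then 1/2 else 0)) := by
  have p0 := zeroTempP_nonneg (grid n) σ v
  have p1 := zeroTempP_le (grid n) σ v
  have hf : FU (Function.update σ v false) ≤ FU σ := by
    unfold FU; exact_mod_cast Finset.card_le_card (upU_update_false σ v)
  have hrem : v ∈ remU σ → FU (Function.update σ v false) ≤ FU σ - 1 := by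
    intro h
    have : ((upU (Function.update σ v false)).card : ℝ) + 1 ≤ (upU σ).card := by
      exact_mod_cast upU_update_false_rem σ v h
    unfold FU; linarith
  have hadd : v ∈ addU σ → FU (Function.update σ v true) ≤ FU σ + 1 := by
    intro h
    unfold FU; exact_mod_cast upU_update_true_add σ v h
  have ht : (v ∈ upU σ ∨ ¬ v.1.val ≤ v.2.val) → FU (Function.update σ v true) ≤ FU σ := by
    intro h
    unfold FU; exact_mod_cast Finset.card_le_card (upU_update_true σ v h)
  have ra : v ∈ remU σ → v ∈ upU σ := fun h => (Finset.mem_filter.1 h).2.1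
  have aa : v ∈ addU σ → v ∉ upU σ := fun h => (Finset.mem_filter.1 h).2.1
  have nbrs : v.1.val < v.2.val → ∃ a b : Fin n × Fin n,
      (a.1.val = v.1.val + 1 ∧ a.2.val = v.2.val) ∧ (b.1.val = v.1.val ∧ b.2.val + 1 = v.2.val) := by
    intro h
    have := v.2.isLt
    refine ⟨(⟨v.1.val + 1, by omega⟩, v.2), (v.1, ⟨v.2.val - 1, by omega⟩), by simp, ?_⟩
    simp; omega
  unfold updMean
  by_cases hd : v ∈ diag n
  · rw [if_pos hd]
    by_cases hr : v ∈ remU σ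
    · have := hrem hr
      rw [if_pos hr]; split_ifs <;> linarith
    · rw [if_neg hr]; split_ifs <;> linarith
  rw [if_neg hd]
  have hne : v.1.val ≠ v.2.val := by
    intro h; apply hd; simp [_root_.diag, Fin.ext_iff, h]
  by_cases hr : v ∈ remU σ
  · have hU := ra hr
    have hna : v ∉ addU σ := fun h => aa h hU
    rw [if_neg hna, if_pos hr]
    have hlt : v.1.val < v.2.val := lt_of_le_of_ne (upU_le hU) hne
    obtain ⟨a, b, ha, hb⟩ := nbrs hlt
    have hmin := (Finset.mem_filter.1 hr).2.2
    have hσa : σ a = false := not_upU_false (fun h => by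
      have := hmin a h (by omega) (by omega)
      rw [this] at ha; omega) (by omega)
    have hσb : σ b = false := not_upU_false (fun h => by
      have := hmin b h (by omega) (by omega)
      rw [this] at hb; omega) (by omega)
    have hp := (zeroTempP_key σ v a b ha hb hσa hσb).1
    have h1 := ht (Or.inl hU)
    have h2 := hrem hr
    nlinarith
  rw [if_neg hr]
  by_cases hU : v ∈ upU σ ∨ ¬ v.1.val ≤ v.2.val
  · have h1 := ht hU
    have : (0:ℝ) ≤ if v ∈ addU σ then 1/2 else 0 := by split_ifs <;> norm_num
    nlinarith
  push Not at hU
  have hlt : v.1.val < v.2.val := lt_of_le_of_ne hU.2 hne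
  obtain ⟨a, b, ha, hb⟩ := nbrs hlt
  have hσa : σ a = false := not_upU_false (fun h => hU.1 (upU_mono h (by omega) (by omega))) (by omega)
  have hσb : σ b = false := not_upU_false (fun h => hU.1 (upU_mono h (by omega) (by omega))) (by omega)
  obtain ⟨hp, hk⟩ := zeroTempP_key σ v a b ha hb hσa hσb
  by_cases hz : zeroTempP (grid n) σ v = 0
  · rw [hz]
    split_ifs <;> linarith
  · obtain ⟨⟨x, hx, hx'⟩, y, hy, hy'⟩ := hk hz
    have hA : v ∈ addU σ := by
      simp only [addU, Finset.mem_filter, Finset.mem_univ, true_and]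
      exact ⟨hU.1, ⟨x, (mem_upU _ _).2 ⟨x, le_rfl, by omega, le_rfl, hx'⟩, hx⟩,
        y, (mem_upU _ _).2 ⟨y, le_rfl, by omega, le_rfl, hy'⟩, hy⟩
    rw [if_pos hA]
    have := hadd hA
    nlinarith

lemma sum_updMean_le {n : ℕ} (σ : Fin n × Fin n → Bool) :
    ∑ v, updMean (grid n) (diag n) FU σ v ≤ (n : ℝ)^2 * FU σ
      - (if (upU σ).Nonempty then 1/2 else 0) := by
  refine (Finset.sum_le_sum fun v _ => updMean_le σ v).trans ?_
  rw [Finset.sum_add_distrib, Finset.sum_sub_distrib, Finset.sum_ite_mem, Finset.sum_ite_mem]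
  simp only [Finset.sum_const, Finset.univ_inter, Finset.card_univ, Fintype.card_prod,
    Fintype.card_fin, nsmul_eq_mul]
  by_cases hne : (upU σ).Nonempty
  · rw [if_pos hne]
    have : ((addU σ).card : ℝ) + 1 ≤ (remU σ).card := by exact_mod_cast count_lt σ hne
    push_cast
    nlinarith
  · rw [if_neg hne]
    have h0 : addU σ = ∅ := by
      rw [Finset.eq_empty_iff_forall_notMem]
      intro v hv
      obtain ⟨-, ⟨x, hx, -⟩, -⟩ := (Finset.mem_filter.1 hv).2
      exact hne ⟨x, hx⟩
    rw [h0]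
    have : (0:ℝ) ≤ (remU σ).card := by positivity
    push_cast
    simp only [Finset.card_empty, Nat.cast_zero]
    nlinarith

lemma nbrSum_swap {n : ℕ} (σ : Fin n × Fin n → Bool) (v : Fin n × Fin n) :
    nbrSum (grid n) (σ ∘ Prod.swap) v.swap = nbrSum (grid n) σ v := by
  unfold nbrSum
  rw [← (Equiv.prodComm (Fin n) (Fin n)).sum_comp]
  refine Finset.sum_congr rfl fun u _ => ?_
  have : (grid n).Adj v.swap ((Equiv.prodComm (Fin n) (Fin n)) u) ↔ (grid n).Adj v u := by
    obtain ⟨a, b⟩ := u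
    obtain ⟨c, d⟩ := v
    simp only [grid, SimpleGraph.fromRel_adj, ne_eq, Equiv.prodComm_apply, Prod.swap_prod_mk,
      Prod.mk.injEq, Fin.ext_iff]
    omega
  rw [Equiv.prodComm_apply] at this
  simp [this]

lemma updMean_swap {n : ℕ} (σ : Fin n × Fin n → Bool) (v : Fin n × Fin n) :
    updMean (grid n) (diag n) (fun τ => FU (τ ∘ Prod.swap)) σ v
      = updMean (grid n) (diag n) FU (σ ∘ Prod.swap) v.swap := by
  have hz : zeroTempP (grid n) (σ ∘ Prod.swap) v.swap = zeroTempP (grid n) σ v := by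
    unfold zeroTempP; rw [nbrSum_swap]
  have hu : ∀ s, Function.update σ v s ∘ Prod.swap = Function.update (σ ∘ Prod.swap) v.swap s := by
    intro s
    funext w
    by_cases hw : w = v.swap
    · subst hw; simp
    · have : w.swap ≠ v := by rintro rfl; simp at hw
      simp [Function.update_of_ne hw, Function.update_of_ne this]
  have hd : v.swap ∈ diag n ↔ v ∈ diag n := by
    simp [_root_.diag, eq_comm]
  unfold updMean
  simp only [hz, hu, hd]

lemma drift {n : ℕ} (hn : 0 < n) (σ : Fin n × Fin n → Bool) (hσ : σ ≠ fun _ => false) :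
    ∑ x, pinnedK0 (grid n) (diag n) false σ x * (FU x + FU (x ∘ Prod.swap))
      ≤ (FU σ + FU (σ ∘ Prod.swap)) - 1 / (2 * (n : ℝ)^2) := by
  rw [pinnedK0_mean (F := fun x => FU x + FU (x ∘ Prod.swap))]
  have e : ∀ v, updMean (grid n) (diag n) (fun x => FU x + FU (x ∘ Prod.swap)) σ v =
      updMean (grid n) (diag n) FU σ v +
      updMean (grid n) (diag n) FU (σ ∘ Prod.swap) ((Equiv.prodComm (Fin n) (Fin n)) v) := by
    intro v
    have := updMean_swap σ v
    rw [Equiv.prodComm_apply, ← this]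
    unfold updMean
    split_ifs <;> ring
  simp only [e]
  rw [Finset.sum_add_distrib, Equiv.sum_comp (Equiv.prodComm (Fin n) (Fin n))
    (fun v => updMean (grid n) (diag n) FU (σ ∘ Prod.swap) v)]
  have h1 := sum_updMean_le σ
  have h2 := sum_updMean_le (σ ∘ Prod.swap)
  have h3 : (1/2 : ℝ) ≤ (if (upU σ).Nonempty then 1/2 else 0) +
      (if (upU (σ ∘ Prod.swap)).Nonempty then 1/2 else 0) := by
    obtain ⟨v, hv⟩ := Function.ne_iff.1 hσ
    have hv : σ v = true := by simpa using hv
    rcases le_total v.1.val v.2.val with h | h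
    · rw [if_pos ⟨v, (mem_upU _ _).2 ⟨v, le_rfl, h, le_rfl, hv⟩⟩]
      split_ifs <;> norm_num
    · rw [if_pos (c := (upU (σ ∘ Prod.swap)).Nonempty)
        ⟨v.swap, (mem_upU _ _).2 ⟨v.swap, le_rfl, h, le_rfl, by simpa using hv⟩⟩]
      split_ifs <;> norm_num
  have hc : (Fintype.card (Fin n × Fin n) : ℝ) = (n:ℝ)^2 := by simp; ring
  rw [hc]
  have hpos : (0:ℝ) < (n:ℝ)^2 := by positivity
  rw [inv_mul_le_iff₀ hpos]
  have : (n:ℝ)^2 * ((FU σ + FU (σ ∘ Prod.swap)) - 1 / (2 * (n : ℝ)^2)) =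
      (n:ℝ)^2 * FU σ + (n:ℝ)^2 * FU (σ ∘ Prod.swap) - 1/2 := by
    field_simp
  rw [this]
  linarith

lemma FU_le {n : ℕ} (σ : Fin n × Fin n → Bool) : FU σ ≤ (n:ℝ)^2 := by
  have : (upU σ).card ≤ n^2 := by
    have := Finset.card_le_univ (upU σ)
    simpa [sq] using this
  unfold FU; exact_mod_cast this

end gridpart

/-- **Zero temperature, corrupted diagonal.** At `β = ∞`, with the diagonal of the
`n × n` grid pinned to `−1`, starting from any configuration that is `+1` off the
diagonal, the corrupted dynamics reaches the all-`−1` configuration in expected time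
`O(n⁵)`: there is a universal constant `C` with `E[inf{t : X̃_t ≡ −1}] ≤ C·n⁵`. -/
theorem zero_temp_diag_flip :
    ∃ C : ℝ, ∀ (n : ℕ) (σ₀ : Fin n × Fin n → Bool),
      (∀ v, v ∉ diag n → σ₀ v = true) →
      expHitTime σ₀ (pinnedK0 (grid n) (diag n) false) (fun _ => false)
        ≤ C * (n : ℝ) ^ 5 := by
  refine ⟨4, fun n σ₀ _ => ?_⟩
  rcases Nat.eq_zero_or_pos n with rfl | hn
  · have : ∀ t, survProb σ₀ (pinnedK0 (grid 0) (diag 0) false) (fun _ => false) t = 0 := by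
      intro t
      unfold survProb
      refine Finset.sum_eq_zero fun h _ => ?_
      rw [if_neg]
      intro hh
      exact hh 0 (Subsingleton.elim _ _)
    simp [expHitTime, this]
  · have h1n : (1:ℝ) ≤ n := by exact_mod_cast hn
    have hpos : (0:ℝ) < (n:ℝ)^2 := by positivity
    have h := expHit_le σ₀ (pinnedK0 (grid n) (diag n) false) (fun _ => false)
      (fun x => FU x + FU (x ∘ Prod.swap)) (1 / (2 * (n : ℝ)^2)) (by positivity)
      (pinnedK0_nonneg _ _ _) (fun σ => by unfold FU; positivity) (fun σ hσ => drift hn σ hσ)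
    refine h.trans ?_
    rw [div_div_eq_mul_div, div_one]
    have h1 := FU_le σ₀
    have h2 := FU_le (σ₀ ∘ Prod.swap)
    calc (FU σ₀ + FU (σ₀ ∘ Prod.swap)) * (2 * (n:ℝ)^2)
        ≤ ((n:ℝ)^2 + (n:ℝ)^2) * (2 * (n:ℝ)^2) := by gcongr
      _ = 4 * (n:ℝ)^4 := by ring
      _ ≤ 4 * (n:ℝ)^5 := by
        have := pow_le_pow_right₀ h1n (show 4 ≤ 5 by norm_num)
        linarith

end
end

section
/- For β a sufficiently large constant there is a constant c=c(β)>0 with the following property: for every γ∈(0,c) there exist δ>0 and n₀ such that for all n≥n₀ and every A⊆[n]² with |A| ≤ δn, the A-corrupted Glauber dynamics on the n×n grid with A pinned to −1 has mixing time at least exp((c−γ)n). In particular, corrupting o(n) vertices cannot move the dynamics from the +1 phase to the −1 phase in sub-exponential time. -/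
open Real Finset
open scoped Classical

noncomputable section

variable {V : Type*} [Fintype V] [DecidableEq V]

/-- Glauber probability of updating `v` to `+1`. -/
def glauberP (β : ℝ) (G : SimpleGraph V) (σ : V → Bool) (v : V) : ℝ :=
  exp (β * nbrSum G σ v) / (exp (β * nbrSum G σ v) + exp (-(β * nbrSum G σ v)))

/-- One-step kernel of the `A`-corrupted Glauber dynamics with `A` pinned to spin `s`. -/
def pinnedK (G : SimpleGraph V) (β : ℝ) (A : Finset V) (s : Bool)
    (σ σ' : V → Bool) : ℝ :=
  (Fintype.card V : ℝ)⁻¹ * ∑ v : V,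
    if v ∈ A then (if σ' = Function.update σ v s then 1 else 0)
    else (if σ' = Function.update σ v true then glauberP β G σ v else 0)
       + (if σ' = Function.update σ v false then 1 - glauberP β G σ v else 0)

/-- Evolution of a distribution under `t` steps of a Markov kernel. -/
def evolve (K : (V → Bool) → (V → Bool) → ℝ) : ℕ → ((V → Bool) → ℝ) → ((V → Bool) → ℝ)
  | 0, ν => ν
  | t+1, ν => fun σ' => ∑ σ : V → Bool, evolve K t ν σ * K σ σ'

/-- Point mass at `σ₀`. -/
def delta (σ₀ : V → Bool) : (V → Bool) → ℝ := fun σ => if σ = σ₀ then 1 else 0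

/-- Total variation distance between two distributions on configurations. -/
def tvDist (ν₁ ν₂ : (V → Bool) → ℝ) : ℝ := (1/2) * ∑ σ : V → Bool, |ν₁ σ - ν₂ σ|

/-- Ising Hamiltonian `H(σ) = ∑_{uv ∈ E} σ(u)σ(v)`. -/
def ham (G : SimpleGraph V) (σ : V → Bool) : ℝ :=
  ∑ e ∈ G.edgeFinset,
    Sym2.lift ⟨fun u v => spinVal (σ u) * spinVal (σ v), fun u v => mul_comm _ _⟩ e

/-- Partition function of the Ising model restricted to configurations that are `s` on `A`. -/
def condZ (G : SimpleGraph V) (β : ℝ) (A : Finset V) (s : Bool) : ℝ :=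
  ∑ σ : V → Bool, if (∀ v ∈ A, σ v = s) then exp (β * ham G σ) else 0

/-- Ising measure conditioned on being `s` on `A`; the stationary distribution of the
`A`-corrupted (pinned) Glauber dynamics. -/
def condIsing (G : SimpleGraph V) (β : ℝ) (A : Finset V) (s : Bool) (σ : V → Bool) : ℝ :=
  if (∀ v ∈ A, σ v = s) then exp (β * ham G σ) / condZ G β A s else 0

/-- (1/4)-mixing time of the kernel `K` with stationary distribution `pi`. -/
def mixingTime (K : (V → Bool) → (V → Bool) → ℝ) (pi : (V → Bool) → ℝ) : ℕ :=
  sInf {t : ℕ | ∀ σ₀ : V → Bool, tvDist (evolve K t (delta σ₀)) pi ≤ 1/4}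

section chain

theorem evolve_linear (K : (V → Bool) → (V → Bool) → ℝ) (t : ℕ) (ν : (V → Bool) → ℝ)
    (x : V → Bool) :
    evolve K t ν x = ∑ σ, ν σ * evolve K t (delta σ) x := by
  induction t generalizing x with
  | zero => simp [evolve, delta]
  | succ t ih =>
    simp only [evolve]
    simp_rw [Finset.mul_sum]
    rw [Finset.sum_comm]
    refine Finset.sum_congr rfl fun y _ => ?_
    rw [ih y, Finset.sum_mul]
    refine Finset.sum_congr rfl fun z _ => ?_
    ring

theorem evolve_add (K : (V → Bool) → (V → Bool) → ℝ) (s t : ℕ) (ν : (V → Bool) → ℝ) :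
    evolve K (t + s) ν = evolve K s (evolve K t ν) := by
  induction s with
  | zero => simp [evolve]
  | succ s ih =>
    rw [← add_assoc]
    simp only [evolve, ih]

theorem evolve_stat (K : (V → Bool) → (V → Bool) → ℝ) (μ : (V → Bool) → ℝ)
    (hst : ∀ y, ∑ x, μ x * K x y = μ y) (t : ℕ) : evolve K t μ = μ := by
  induction t with
  | zero => rfl
  | succ t ih => simp only [evolve, ih]; funext y; exact hst y

theorem evolve_nonneg (K : (V → Bool) → (V → Bool) → ℝ) (h0 : ∀ x y, 0 ≤ K x y) (t : ℕ)
    (ν : (V → Bool) → ℝ) (hν : ∀ x, 0 ≤ ν x) (x : V → Bool) : 0 ≤ evolve K t ν x := by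
  induction t generalizing x with
  | zero => exact hν x
  | succ t ih => exact Finset.sum_nonneg fun y _ => mul_nonneg (ih y) (h0 _ _)

theorem evolve_sum (K : (V → Bool) → (V → Bool) → ℝ) (h1 : ∀ x, ∑ y, K x y = 1) (t : ℕ)
    (ν : (V → Bool) → ℝ) : ∑ x, evolve K t ν x = ∑ x, ν x := by
  induction t with
  | zero => rfl
  | succ t ih =>
    simp only [evolve]
    rw [Finset.sum_comm, ← ih]
    refine Finset.sum_congr rfl fun y _ => ?_
    rw [← Finset.mul_sum, h1, mul_one]

theorem evolve_mono (K : (V → Bool) → (V → Bool) → ℝ) (h0 : ∀ x y, 0 ≤ K x y) (t : ℕ)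
    (ν ν' : (V → Bool) → ℝ) (hν : ∀ x, ν x ≤ ν' x) (x : V → Bool) :
    evolve K t ν x ≤ evolve K t ν' x := by
  induction t generalizing x with
  | zero => exact hν x
  | succ t ih => exact Finset.sum_le_sum fun y _ => mul_le_mul_of_nonneg_right (ih y) (h0 _ _)

theorem exists_mix (K : (V → Bool) → (V → Bool) → ℝ) (μ : (V → Bool) → ℝ)
    (h0 : ∀ x y, 0 ≤ K x y) (h1 : ∀ x, ∑ y, K x y = 1)
    (hst : ∀ y, ∑ x, μ x * K x y = μ y) (hμ : ∀ x, 0 ≤ μ x) (hμ1 : ∑ x, μ x = 1)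
    (t₀ : ℕ) (x₀ : V → Bool) (hpos : ∀ σ, 0 < evolve K t₀ (delta σ) x₀) :
    ∃ t, ∀ σ, tvDist (evolve K t (delta σ)) μ ≤ 1/4 := by
  have hd0 : ∀ σ x : V → Bool, 0 ≤ delta σ x := by
    intro σ x; unfold delta; split_ifs <;> norm_num
  have hd1 : ∀ σ : V → Bool, ∑ x, delta σ x = 1 := by
    intro σ; simp [delta]
  obtain ⟨σm, -, hm⟩ := Finset.exists_min_image (Finset.univ : Finset (V → Bool))
    (fun σ => evolve K t₀ (delta σ) x₀) ⟨x₀, Finset.mem_univ _⟩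
  set ε := evolve K t₀ (delta σm) x₀ with hε
  have hεpos : 0 < ε := hpos σm
  have hM1 : ∀ σ, ∑ x, evolve K t₀ (delta σ) x = 1 := fun σ => by
    rw [evolve_sum K h1, hd1]
  have hM0 : ∀ σ x, 0 ≤ evolve K t₀ (delta σ) x := fun σ x => evolve_nonneg K h0 _ _ (hd0 σ) x
  have hεle : ε ≤ 1 := by
    rw [← hM1 σm]
    exact Finset.single_le_sum (f := fun x => evolve K t₀ (delta σm) x)
      (fun x _ => hM0 σm x) (Finset.mem_univ x₀)
  have contr : ∀ ν : (V → Bool) → ℝ, ∑ x, ν x = 1 →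
      ∑ x, |evolve K t₀ ν x - μ x| ≤ (1 - ε) * ∑ x, |ν x - μ x| := by
    intro ν hν
    have key : ∀ x, evolve K t₀ ν x - μ x =
        ∑ σ, (ν σ - μ σ) * (evolve K t₀ (delta σ) x - ε * delta x₀ x) := by
      intro x
      have e1 := evolve_linear K t₀ ν x
      have e2 := evolve_linear K t₀ μ x
      rw [evolve_stat K μ hst] at e2
      simp_rw [mul_sub, sub_mul, Finset.sum_sub_distrib]
      rw [← e1, ← e2, ← Finset.sum_mul, ← Finset.sum_mul, hν, hμ1]
      ring
    calc ∑ x, |evolve K t₀ ν x - μ x|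
        ≤ ∑ x, ∑ σ, |ν σ - μ σ| * (evolve K t₀ (delta σ) x - ε * delta x₀ x) := by
          refine Finset.sum_le_sum fun x _ => ?_
          rw [key x]
          refine (Finset.abs_sum_le_sum_abs _ _).trans (Finset.sum_le_sum fun σ _ => ?_)
          rw [abs_mul]
          refine le_of_eq ?_
          congr 1
          apply abs_of_nonneg
          unfold delta
          split_ifs with h
          · subst h
            have := hm σ (Finset.mem_univ _)
            unfold delta at this
            simp only [mul_one]
            linarith
          · have := hM0 σ x
            unfold delta at this
            simpa using this
      _ = (1 - ε) * ∑ x, |ν x - μ x| := by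
          rw [Finset.sum_comm, Finset.mul_sum]
          refine Finset.sum_congr rfl fun σ _ => ?_
          rw [← Finset.mul_sum, Finset.sum_sub_distrib, hM1, ← Finset.mul_sum, hd1]
          ring
  have iter : ∀ m : ℕ, ∀ σ, ∑ x, |evolve K (m * t₀) (delta σ) x - μ x| ≤ (1 - ε) ^ m * 2 := by
    intro m σ
    induction m with
    | zero =>
      simp only [Nat.zero_mul, evolve, pow_zero, one_mul]
      calc ∑ x, |delta σ x - μ x| ≤ ∑ x, (delta σ x + μ x) := by
            refine Finset.sum_le_sum fun x _ => ?_
            rw [abs_le]; constructor <;> linarith [hd0 σ x, hμ x]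
        _ = 2 := by rw [Finset.sum_add_distrib, hd1, hμ1]; norm_num
    | succ m ih =>
      rw [Nat.succ_mul, evolve_add]
      refine (contr _ (by rw [evolve_sum K h1, hd1])).trans ?_
      rw [pow_succ]
      nlinarith [mul_le_mul_of_nonneg_left ih (sub_nonneg.2 hεle)]
  obtain ⟨m, hm'⟩ := exists_pow_lt_of_lt_one (show (0:ℝ) < 1/4 by norm_num)
    (show 1 - ε < 1 by linarith)
  refine ⟨m * t₀, fun σ => ?_⟩
  unfold tvDist
  linarith [iter m σ]

theorem bottleneck (K : (V → Bool) → (V → Bool) → ℝ) (μ : (V → Bool) → ℝ)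
    (h0 : ∀ x y, 0 ≤ K x y) (h1 : ∀ x, ∑ y, K x y = 1)
    (hst : ∀ y, ∑ x, μ x * K x y = μ y) (hμ : ∀ x, 0 ≤ μ x) (hμ1 : ∑ x, μ x = 1)
    (S L : Finset (V → Bool)) (hS : 0 < ∑ x ∈ S, μ x) (hS2 : ∑ x ∈ S, μ x ≤ 1/2)
    (hSL : ∀ x ∈ S, ∀ y, K x y ≠ 0 → y ∈ S ∨ y ∈ L) (t : ℕ)
    (ht : ∀ σ, tvDist (evolve K t (delta σ)) μ ≤ 1/4) :
    1/4 * ∑ x ∈ S, μ x ≤ t * ∑ x ∈ L, μ x := by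
  set s := ∑ x ∈ S, μ x with hs
  set l := ∑ x ∈ L, μ x with hl
  let ν : (V → Bool) → ℝ := fun x => if x ∈ S then μ x else 0
  have hν0 : ∀ x, 0 ≤ ν x := fun x => by simp only [ν]; split_ifs; exacts [hμ x, le_rfl]
  have hνμ : ∀ x, ν x ≤ μ x := fun x => by simp only [ν]; split_ifs; exacts [le_rfl, hμ x]
  have hν1 : ∑ x, ν x = s := by simp [ν, hs]
  have hle : ∀ t x, evolve K t ν x ≤ μ x := fun t x => by
    have := evolve_mono K h0 t ν μ hνμ x
    rwa [evolve_stat K μ hst] at this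
  have hn : ∀ t x, 0 ≤ evolve K t ν x := fun t x => evolve_nonneg K h0 t ν hν0 x
  -- escape bound
  have esc : ∀ t : ℕ, ∑ y ∈ Sᶜ, evolve K t ν y ≤ t * l := by
    intro t
    induction t with
    | zero =>
      simp only [evolve, Nat.cast_zero, zero_mul]
      refine (Finset.sum_eq_zero fun y hy => ?_).le
      simp only [ν, if_neg (Finset.mem_compl.1 hy)]
    | succ t ih =>
      have e1 : ∑ y ∈ Sᶜ, evolve K (t+1) ν y =
          ∑ x ∈ S, evolve K t ν x * ∑ y ∈ Sᶜ, K x y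
          + ∑ x ∈ Sᶜ, evolve K t ν x * ∑ y ∈ Sᶜ, K x y := by
        rw [Finset.sum_add_sum_compl]
        simp only [evolve]
        rw [Finset.sum_comm]
        exact Finset.sum_congr rfl fun x _ => by rw [Finset.mul_sum]
      have e2 : ∑ x ∈ Sᶜ, evolve K t ν x * ∑ y ∈ Sᶜ, K x y ≤ ∑ x ∈ Sᶜ, evolve K t ν x := by
        refine Finset.sum_le_sum fun x _ => mul_le_of_le_one_right (hn t x) ?_
        rw [← h1 x]
        exact Finset.sum_le_sum_of_subset_of_nonneg (Finset.subset_univ _) fun y _ _ => h0 x y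
      have e3 : ∑ x ∈ S, evolve K t ν x * ∑ y ∈ Sᶜ, K x y ≤ l := by
        calc ∑ x ∈ S, evolve K t ν x * ∑ y ∈ Sᶜ, K x y
            ≤ ∑ x ∈ S, μ x * ∑ y ∈ L, K x y := by
              refine Finset.sum_le_sum fun x hx => mul_le_mul (hle t x) ?_
                (Finset.sum_nonneg fun y _ => h0 x y) (hμ x)
              calc ∑ y ∈ Sᶜ, K x y = ∑ y ∈ Sᶜ ∩ L, K x y := by
                    symm
                    refine Finset.sum_subset Finset.inter_subset_left fun y hy hy' => ?_
                    by_contra h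
                    rcases hSL x hx y h with h | h
                    · exact (Finset.mem_compl.1 hy) h
                    · exact hy' (Finset.mem_inter.2 ⟨hy, h⟩)
                _ ≤ _ := Finset.sum_le_sum_of_subset_of_nonneg Finset.inter_subset_right
                    fun y _ _ => h0 x y
          _ ≤ ∑ x, μ x * ∑ y ∈ L, K x y :=
              Finset.sum_le_sum_of_subset_of_nonneg (Finset.subset_univ _) fun x _ _ =>
                mul_nonneg (hμ x) (Finset.sum_nonneg fun y _ => h0 x y)
          _ = l := by
              simp_rw [Finset.mul_sum]
              rw [Finset.sum_comm]
              exact Finset.sum_congr rfl fun y _ => hst y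
      push_cast
      linarith
  -- TV bound
  have tv : ∑ x, |evolve K t ν x - s * μ x| ≤ s * (1/2) := by
    calc ∑ x, |evolve K t ν x - s * μ x|
        ≤ ∑ x, ∑ σ, ν σ * |evolve K t (delta σ) x - μ x| := by
          refine Finset.sum_le_sum fun x _ => ?_
          have : evolve K t ν x - s * μ x = ∑ σ, ν σ * (evolve K t (delta σ) x - μ x) := by
            rw [evolve_linear]
            simp_rw [mul_sub, Finset.sum_sub_distrib]
            rw [← Finset.sum_mul, hν1]
          rw [this]
          refine (Finset.abs_sum_le_sum_abs _ _).trans (Finset.sum_le_sum fun σ _ => ?_)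
          rw [abs_mul, abs_of_nonneg (hν0 σ)]
      _ = ∑ σ, ν σ * ∑ x, |evolve K t (delta σ) x - μ x| := by
          rw [Finset.sum_comm]
          exact Finset.sum_congr rfl fun x _ => by rw [Finset.mul_sum]
      _ ≤ ∑ σ, ν σ * (1/2) := by
          refine Finset.sum_le_sum fun σ _ => mul_le_mul_of_nonneg_left ?_ (hν0 σ)
          have := ht σ
          unfold tvDist at this
          linarith
      _ = s * (1/2) := by rw [← Finset.sum_mul, hν1]
  have hc : ∑ x ∈ S, μ x + ∑ x ∈ Sᶜ, μ x = 1 := by rw [Finset.sum_add_sum_compl, hμ1]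
  have hc2 : ∑ x ∈ S, evolve K t ν x + ∑ x ∈ Sᶜ, evolve K t ν x = s := by
    rw [Finset.sum_add_sum_compl, evolve_sum K h1, hν1]
  have hc3 := Finset.sum_add_sum_compl S (fun x => |evolve K t ν x - s * μ x|)
  have a1 : ∑ x ∈ Sᶜ, (s * μ x - evolve K t ν x) ≤ ∑ x ∈ Sᶜ, |evolve K t ν x - s * μ x| :=
    Finset.sum_le_sum fun x _ => by rw [abs_sub_comm]; exact le_abs_self _
  have a2 : ∑ x ∈ S, (evolve K t ν x - s * μ x) ≤ ∑ x ∈ S, |evolve K t ν x - s * μ x| :=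
    Finset.sum_le_sum fun x _ => le_abs_self _
  rw [Finset.sum_sub_distrib, ← Finset.mul_sum] at a1 a2
  have := esc t
  nlinarith

end chain

section pinned

theorem ham_update (G : SimpleGraph V) (σ : V → Bool) (v : V) :
    ∃ C : ℝ, ∀ b, ham G (Function.update σ v b) = C + spinVal b * nbrSum G σ v := by
  refine ⟨∑ e ∈ G.edgeFinset.filter (fun e => v ∉ e),
    Sym2.lift ⟨fun u v => spinVal (σ u) * spinVal (σ v), fun u v => mul_comm _ _⟩ e, fun b => ?_⟩
  unfold ham
  rw [← Finset.sum_filter_add_sum_filter_not G.edgeFinset (fun e => v ∉ e)]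
  congr 1
  · refine Finset.sum_congr rfl fun e he => ?_
    rw [Finset.mem_filter] at he
    obtain ⟨-, he⟩ := he
    induction e using Sym2.ind with
    | _ x y =>
      simp only [Sym2.mem_iff, not_or] at he
      simp only [Sym2.lift_mk]
      rw [Function.update_of_ne (Ne.symm he.1), Function.update_of_ne (Ne.symm he.2)]
  · unfold nbrSum
    rw [← Finset.sum_filter, Finset.mul_sum]
    symm
    refine Finset.sum_bij (fun u _ => s(v, u)) ?_ ?_ ?_ ?_
    · intro u hu
      simp only [Finset.mem_filter, Finset.mem_univ, true_and] at hu
      simp [hu]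
    · intro a _ b _ h
      exact Sym2.congr_right.1 h
    · intro e he
      simp only [Finset.mem_filter, not_not, SimpleGraph.mem_edgeFinset] at he
      obtain ⟨he, hv⟩ := he
      obtain ⟨u, rfl⟩ := hv
      exact ⟨u, by simpa using he, rfl⟩
    · intro u hu
      simp only [Finset.mem_filter, Finset.mem_univ, true_and] at hu
      simp only [Sym2.lift_mk, Function.update_self]
      rw [Function.update_of_ne hu.ne']

theorem nbrSum_update (G : SimpleGraph V) (σ : V → Bool) (v : V) (b : Bool) :
    nbrSum G (Function.update σ v b) v = nbrSum G σ v := by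
  unfold nbrSum
  refine Finset.sum_congr rfl fun u _ => ?_
  by_cases h : G.Adj v u
  · rw [if_pos h, if_pos h, Function.update_of_ne h.ne']
  · rw [if_neg h, if_neg h]

theorem glauberP_pos (β : ℝ) (G : SimpleGraph V) (σ : V → Bool) (v : V) :
    0 < glauberP β G σ v := by unfold glauberP; positivity

theorem glauberP_lt (β : ℝ) (G : SimpleGraph V) (σ : V → Bool) (v : V) :
    glauberP β G σ v < 1 := by
  unfold glauberP
  rw [div_lt_one (by positivity)]
  linarith [exp_pos (-(β * nbrSum G σ v))]

theorem pinnedK_nonneg (G : SimpleGraph V) (β : ℝ) (A : Finset V) (s : Bool)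
    (σ σ' : V → Bool) : 0 ≤ pinnedK G β A s σ σ' := by
  unfold pinnedK
  refine mul_nonneg (by positivity) (Finset.sum_nonneg fun v _ => ?_)
  have h1 := glauberP_pos β G σ v
  have h2 := glauberP_lt β G σ v
  split_ifs <;> linarith

theorem pinnedK_sum [Nonempty V] (G : SimpleGraph V) (β : ℝ) (A : Finset V) (s : Bool)
    (σ : V → Bool) : ∑ σ', pinnedK G β A s σ σ' = 1 := by
  unfold pinnedK
  rw [← Finset.mul_sum, Finset.sum_comm]
  have : ∀ v ∈ (Finset.univ : Finset V), (∑ σ' : V → Bool,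
     if v ∈ A then (if σ' = Function.update σ v s then (1:ℝ) else 0)
    else (if σ' = Function.update σ v true then glauberP β G σ v else 0)
       + (if σ' = Function.update σ v false then 1 - glauberP β G σ v else 0)) = 1 := by
    intro v _
    by_cases h : v ∈ A
    · simp [h]
    · simp [h, Finset.sum_add_distrib]
  rw [Finset.sum_congr rfl this]
  simp

theorem condZ_pos (G : SimpleGraph V) (β : ℝ) (A : Finset V) (s : Bool) :
    0 < condZ G β A s := by
  unfold condZ
  refine Finset.sum_pos' (fun σ _ => ?_) ⟨fun _ => s, Finset.mem_univ _, ?_⟩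
  · split_ifs <;> positivity
  · simp [exp_pos]

theorem condIsing_nonneg (G : SimpleGraph V) (β : ℝ) (A : Finset V) (s : Bool) (σ : V → Bool) :
    0 ≤ condIsing G β A s σ := by
  unfold condIsing
  have := condZ_pos G β A s
  split_ifs <;> positivity

theorem condIsing_sum (G : SimpleGraph V) (β : ℝ) (A : Finset V) (s : Bool) :
    ∑ σ, condIsing G β A s σ = 1 := by
  have h := condZ_pos G β A s
  have : ∀ σ, condIsing G β A s σ =
      (if (∀ v ∈ A, σ v = s) then exp (β * ham G σ) else 0) / condZ G β A s := by
    intro σ; unfold condIsing; split_ifs <;> simp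
  simp_rw [this]
  rw [← Finset.sum_div]
  exact div_self h.ne'

/-- two-state balance -/
theorem condIsing_balance (G : SimpleGraph V) (β : ℝ) (A : Finset V) (s : Bool) (σ : V → Bool)
    (v : V) (hv : v ∉ A) :
    condIsing G β A s (Function.update σ v true) * (1 - glauberP β G σ v)
      = condIsing G β A s (Function.update σ v false) * glauberP β G σ v := by
  have hc : ∀ b, (∀ u ∈ A, Function.update σ v b u = s) ↔ ∀ u ∈ A, σ u = s := by
    intro b
    refine forall₂_congr fun u hu => ?_
    rw [Function.update_of_ne (by rintro rfl; exact hv hu)]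
  unfold condIsing
  simp only [hc]
  split_ifs
  swap
  · simp
  obtain ⟨C, hC⟩ := ham_update G σ v
  rw [hC, hC]
  unfold glauberP
  set m := nbrSum G σ v
  have hp : 0 < exp (β * m) + exp (-(β * m)) := by positivity
  have hz := condZ_pos G β A s
  have e1 : exp (β * (C + spinVal true * m)) = exp (β * C) * exp (β * m) := by
    rw [← exp_add]; congr 1; simp [spinVal]; ring
  have e2 : exp (β * (C + spinVal false * m)) = exp (β * C) * exp (-(β * m)) := by
    rw [← exp_add]; congr 1; simp [spinVal]; ring
  rw [e1, e2]
  field_simp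
  ring

theorem pinned_stat [Nonempty V] (G : SimpleGraph V) (β : ℝ) (A : Finset V) (s : Bool)
    (σ' : V → Bool) :
    ∑ σ, condIsing G β A s σ * pinnedK G β A s σ σ' = condIsing G β A s σ' := by
  unfold pinnedK
  have key : ∀ v ∈ (Finset.univ : Finset V), ∑ σ : V → Bool, condIsing G β A s σ *
    (if v ∈ A then (if σ' = Function.update σ v s then 1 else 0)
    else (if σ' = Function.update σ v true then glauberP β G σ v else 0)
       + (if σ' = Function.update σ v false then 1 - glauberP β G σ v else 0))
      = condIsing G β A s σ' := by
    intro v _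
    by_cases hv : v ∈ A
    · simp only [hv, if_true]
      rw [Finset.sum_eq_single σ']
      · by_cases h : σ' v = s
        · rw [if_pos (by rw [← h, Function.update_eq_self]), mul_one]
        · have : condIsing G β A s σ' = 0 := by
            unfold condIsing
            rw [if_neg]
            exact fun h' => h (h' v hv)
          rw [this, zero_mul]
      · intro σ _ hne
        by_cases h : σ v = s
        · rw [if_neg, mul_zero]
          rw [← h, Function.update_eq_self]
          exact hne.symm
        · have : condIsing G β A s σ = 0 := by
            unfold condIsing
            rw [if_neg]
            exact fun h' => h (h' v hv)
          rw [this, zero_mul]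
      · simp
    · simp only [hv, if_false]
      have hne : Function.update σ' v true ≠ Function.update σ' v false := by
        intro h
        have := congrFun h v
        simp at this
      rw [← Finset.sum_subset (Finset.subset_univ {Function.update σ' v true, Function.update σ' v false})]
      · rw [Finset.sum_pair hne]
        have hg : ∀ b, glauberP β G (Function.update σ' v b) v = glauberP β G σ' v := by
          intro b; unfold glauberP; rw [nbrSum_update]
        simp only [Function.update_idem, hg]
        have hb := condIsing_balance G β A s σ' v hv
        have hu : ∀ b, (σ' = Function.update σ' v b) ↔ σ' v = b := by
          intro b
          rw [Function.eq_update_self_iff]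
        simp only [hu]
        cases h : σ' v
        · have h' : Function.update σ' v false = σ' := by rw [← h, Function.update_eq_self]
          rw [h'] at hb ⊢
          simp only [Bool.false_eq_true, if_false, if_true, zero_add]
          linarith
        · have h' : Function.update σ' v true = σ' := by rw [← h, Function.update_eq_self]
          rw [h'] at hb ⊢
          simp only [Bool.true_eq_false, if_false, if_true, add_zero]
          linarith
      · intro σ _ hσ
        simp only [Finset.mem_insert, Finset.mem_singleton, not_or] at hσ
        have : ∀ b, σ' ≠ Function.update σ v b := by
          intro b hb
          have h2 : σ = Function.update σ' v (σ v) := by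
            rw [hb, Function.update_idem, Function.update_eq_self]
          cases h : σ v
          · rw [h] at h2; exact hσ.2 h2
          · rw [h] at h2; exact hσ.1 h2
        simp [this]
  have : ∀ σ : V → Bool, condIsing G β A s σ * ((Fintype.card V : ℝ)⁻¹ * ∑ v : V,
    if v ∈ A then (if σ' = Function.update σ v s then 1 else 0)
    else (if σ' = Function.update σ v true then glauberP β G σ v else 0)
       + (if σ' = Function.update σ v false then 1 - glauberP β G σ v else 0)) =
    (Fintype.card V : ℝ)⁻¹ * ∑ v : V, condIsing G β A s σ *
    (if v ∈ A then (if σ' = Function.update σ v s then 1 else 0)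
    else (if σ' = Function.update σ v true then glauberP β G σ v else 0)
       + (if σ' = Function.update σ v false then 1 - glauberP β G σ v else 0)) := by
    intro σ
    rw [← Finset.mul_sum]; ring
  simp_rw [this]
  rw [← Finset.mul_sum, Finset.sum_comm, Finset.sum_congr rfl key]
  simp

theorem pinned_step_pos [Nonempty V] (G : SimpleGraph V) (β : ℝ) (A : Finset V) 
    (σ : V → Bool) (v : V) : 0 < pinnedK G β A false σ (Function.update σ v false) := by
  unfold pinnedK
  refine mul_pos (by positivity) (Finset.sum_pos' (fun u _ => ?_) ⟨v, Finset.mem_univ _, ?_⟩)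
  · have h1 := glauberP_pos β G σ u
    have h2 := glauberP_lt β G σ u
    split_ifs <;> linarith
  · have h1 := glauberP_pos β G σ v
    have h2 := glauberP_lt β G σ v
    simp only [if_true]
    split_ifs <;> linarith

theorem pinned_reach [Nonempty V] (G : SimpleGraph V) (β : ℝ) (A : Finset V) (σ : V → Bool)
    (T : Finset V) :
    0 < evolve (pinnedK G β A false) T.card (delta σ) (fun v => if v ∈ T then false else σ v) := by
  induction T using Finset.induction_on with
  | empty => simp [evolve, delta]
  | insert v T hv ih =>
    rw [Finset.card_insert_of_notMem hv]
    simp only [evolve]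
    refine Finset.sum_pos' (fun x _ => mul_nonneg (evolve_nonneg _ (pinnedK_nonneg G β A false) _ _
      (fun x => ?_) _) (pinnedK_nonneg _ _ _ _ _ _)) ⟨_, Finset.mem_univ _, mul_pos ih ?_⟩
    · unfold delta; split_ifs <;> norm_num
    · have he : (fun u => if u ∈ insert v T then false else σ u) =
          Function.update (fun u => if u ∈ T then false else σ u) v false := by
        funext u
        by_cases h : u = v
        · subst h; simp
        · simp [h]
      rw [he]
      exact pinned_step_pos G β A _ v

theorem pinned_mix [Nonempty V] (G : SimpleGraph V) (β : ℝ) (A : Finset V) :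
    ∃ t, ∀ σ, tvDist (evolve (pinnedK G β A false) t (delta σ)) (condIsing G β A false) ≤ 1/4 := by
  refine exists_mix _ _ (pinnedK_nonneg G β A false) (pinnedK_sum G β A false)
    (pinned_stat G β A false) (condIsing_nonneg G β A false) (condIsing_sum G β A false)
    (Finset.univ : Finset V).card (fun _ => false) (fun σ => ?_)
  have := pinned_reach G β A σ Finset.univ
  simpa using this

theorem pinned_support (G : SimpleGraph V) (β : ℝ) (A : Finset V) (s : Bool) (σ σ' : V → Bool)
    (h : pinnedK G β A s σ σ' ≠ 0) : ∃ v b, σ' = Function.update σ v b := by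
  by_contra hc
  push Not at hc
  apply h
  unfold pinnedK
  simp [hc]

end pinned

section components

variable {P : Type*} [Fintype P]

/-- Connected component of `p` in the set `Y` for the relation `r`. -/
def cpt (r : P → P → Prop) (Y : Finset P) (p : P) : Finset P :=
  Finset.univ.filter (fun q => Relation.ReflTransGen (fun a b => a ∈ Y ∧ b ∈ Y ∧ r a b) p q)

theorem cpt_self (r : P → P → Prop) (Y : Finset P) (p : P) : p ∈ cpt r Y p := by
  simp [cpt, Relation.ReflTransGen.refl]

theorem cpt_subset (r : P → P → Prop) (Y : Finset P) (p : P) (hp : p ∈ Y) : cpt r Y p ⊆ Y := by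
  intro q hq
  simp only [cpt, Finset.mem_filter, Finset.mem_univ, true_and] at hq
  induction hq with
  | refl => exact hp
  | tail _ h _ => exact h.2.1

theorem cpt_step (r : P → P → Prop) (Y : Finset P) (p : P) (hp : p ∈ Y) {a b : P}
    (ha : a ∈ cpt r Y p) (hb : b ∈ Y) (hab : r a b) : b ∈ cpt r Y p := by
  have haY := cpt_subset r Y p hp ha
  simp only [cpt, Finset.mem_filter, Finset.mem_univ, true_and] at ha ⊢
  exact ha.tail ⟨haY, hb, hab⟩

theorem cpt_eq (r : P → P → Prop) (hr : ∀ a b, r a b → r b a) (Y : Finset P) (p q : P)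
    (hq : q ∈ cpt r Y p) : cpt r Y q = cpt r Y p := by
  simp only [cpt, Finset.mem_filter, Finset.mem_univ, true_and] at hq
  have hs : Relation.ReflTransGen (fun a b => a ∈ Y ∧ b ∈ Y ∧ r a b) q p := by
    clear * - hq hr
    induction hq with
    | refl => exact Relation.ReflTransGen.refl
    | tail _ h ih => exact Relation.ReflTransGen.head ⟨h.2.1, h.1, hr _ _ h.2.2⟩ ih
  ext x
  simp only [cpt, Finset.mem_filter, Finset.mem_univ, true_and]
  exact ⟨fun h => hq.trans h, fun h => hs.trans h⟩

theorem cpt_congr (r : P → P → Prop) (hrefl : ∀ a, r a a) (Y Y' : Finset P) (p : P) (hp : p ∈ Y)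
    (h : ∀ k ∈ cpt r Y p, ∀ q, r k q → (q ∈ Y ↔ q ∈ Y')) : cpt r Y' p = cpt r Y p := by
  ext q
  constructor
  · intro hq
    have hq' := hq
    simp only [cpt, Finset.mem_filter, Finset.mem_univ, true_and] at hq'
    clear hq
    induction hq' with
    | refl => exact cpt_self r Y p
    | tail _ hs ih => exact cpt_step r Y p hp ih ((h _ ih _ hs.2.2).2 hs.2.1) hs.2.2
  · intro hq
    have hq' := hq
    simp only [cpt, Finset.mem_filter, Finset.mem_univ, true_and] at hq'
    clear hq
    induction hq' with
    | refl => exact cpt_self r Y' p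
    | @tail b c hb hs ih =>
      have hbm : b ∈ cpt r Y p := by simpa [cpt] using hb
      have hcm : c ∈ cpt r Y p := cpt_step r Y p hp hbm hs.2.1 hs.2.2
      have hpY' : p ∈ Y' := (h p (cpt_self r Y p) p (hrefl p)).1 hp
      exact cpt_step r Y' p hpY' ih ((h c hcm c (hrefl c)).1 hs.2.1) hs.2.2

theorem cpt_count (r : P → P → Prop) (hrefl : ∀ a, r a a) (d : ℕ)
    (hd : ∀ a, (Finset.univ.filter (fun b => r a b)).card ≤ d) (p : P) (l : ℕ) :
    (Finset.univ.filter (fun K : Finset P => K.card = l ∧ ∃ Y : Finset P, p ∈ Y ∧ cpt r Y p = K)).card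
      ≤ 2 ^ (d * l) := by
  set F := Finset.univ.filter
    (fun K : Finset P => K.card = l ∧ ∃ Y : Finset P, p ∈ Y ∧ cpt r Y p = K) with hF
  set N := Fintype.card P with hN
  have fib : ∀ K ∈ F, 2 ^ N ≤
      (Finset.univ.filter (fun Y : Finset P => cpt r Y p = K)).card * 2 ^ (d * l) := by
    intro K hK
    simp only [hF, Finset.mem_filter, Finset.mem_univ, true_and] at hK
    obtain ⟨hKl, Y, hpY, hYK⟩ := hK
    set NK := K.biUnion (fun k => Finset.univ.filter (fun b => r k b)) with hNK
    have hNKc : NK.card ≤ d * l := by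
      rw [← hKl, mul_comm]
      exact Finset.card_biUnion_le_card_mul _ _ _ fun k _ => hd k
    have hKN : K ⊆ NK := by
      intro k hk
      rw [hNK, Finset.mem_biUnion]
      exact ⟨k, hk, by simp [hrefl]⟩
    have hpK : p ∈ K := hYK ▸ cpt_self r Y p
    have hsub : (NKᶜ.powerset).image (fun Z => K ∪ Z) ⊆
        Finset.univ.filter (fun Y : Finset P => cpt r Y p = K) := by
      intro Y' hY'
      rw [Finset.mem_image] at hY'
      obtain ⟨Z, hZ, rfl⟩ := hY'
      rw [Finset.mem_powerset] at hZ
      simp only [Finset.mem_filter, Finset.mem_univ, true_and]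
      rw [← hYK]
      nth_rewrite 2 [← cpt_congr r hrefl Y (cpt r Y p ∪ Z) p hpY]
      · rfl
      · intro k hk q hkq
        have hkK : k ∈ K := hYK ▸ hk
        have hqN : q ∈ NK := by
          rw [hNK, Finset.mem_biUnion]
          exact ⟨k, hkK, by simp [hkq]⟩
        have hqZ : q ∉ Z := fun h => (Finset.mem_compl.1 (hZ h)) hqN
        simp only [Finset.mem_union, hqZ, or_false]
        exact ⟨fun h => cpt_step r Y p hpY hk h hkq, fun h => cpt_subset r Y p hpY h⟩
    have hcard : ((NKᶜ.powerset).image (fun Z => K ∪ Z)).card = 2 ^ (N - NK.card) := by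
      rw [Finset.card_image_of_injOn, Finset.card_powerset, Finset.card_compl]
      intro Z hZ Z' hZ' h
      have hZ1 : Z ⊆ NKᶜ := Finset.mem_powerset.1 (Finset.mem_coe.1 hZ)
      have hZ2 : Z' ⊆ NKᶜ := Finset.mem_powerset.1 (Finset.mem_coe.1 hZ')
      have h' : K ∪ Z = K ∪ Z' := h
      ext x
      have hx := Finset.ext_iff.1 h' x
      simp only [Finset.mem_union] at hx
      constructor
      · intro hxZ
        rcases hx.1 (Or.inr hxZ) with h1 | h1
        · exact absurd (hKN h1) (Finset.mem_compl.1 (hZ1 hxZ))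
        · exact h1
      · intro hxZ
        rcases hx.2 (Or.inr hxZ) with h1 | h1
        · exact absurd (hKN h1) (Finset.mem_compl.1 (hZ2 hxZ))
        · exact h1
    have hle := Finset.card_le_card hsub
    rw [hcard] at hle
    calc 2 ^ N ≤ 2 ^ ((N - NK.card) + d * l) := Nat.pow_le_pow_right (by norm_num) (by omega)
      _ = 2 ^ (N - NK.card) * 2 ^ (d * l) := pow_add _ _ _
      _ ≤ _ := Nat.mul_le_mul_right _ hle
  have tot : ∑ K ∈ F, (Finset.univ.filter (fun Y : Finset P => cpt r Y p = K)).card ≤ 2 ^ N := by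
    have h1 : ∑ K : Finset P, (Finset.univ.filter (fun Y : Finset P => cpt r Y p = K)).card
        = (Finset.univ : Finset (Finset P)).card :=
      (Finset.card_eq_sum_card_fiberwise (fun Y _ => Finset.mem_univ _)).symm
    calc _ ≤ ∑ K : Finset P, (Finset.univ.filter (fun Y : Finset P => cpt r Y p = K)).card :=
          Finset.sum_le_sum_of_subset (Finset.subset_univ _)
      _ = 2 ^ N := by rw [h1, Finset.card_univ, Fintype.card_finset]
  have h2 : F.card * 2 ^ N ≤ 2 ^ N * 2 ^ (d * l) := by
    calc F.card * 2 ^ N = ∑ K ∈ F, 2 ^ N := by rw [Finset.sum_const, smul_eq_mul]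
      _ ≤ ∑ K ∈ F, (Finset.univ.filter (fun Y : Finset P => cpt r Y p = K)).card * 2 ^ (d * l) :=
          Finset.sum_le_sum fib
      _ = (∑ K ∈ F, (Finset.univ.filter (fun Y : Finset P => cpt r Y p = K)).card) * 2 ^ (d * l) := by
          rw [Finset.sum_mul]
      _ ≤ _ := Nat.mul_le_mul_right _ tot
  rw [mul_comm] at h2
  exact Nat.le_of_mul_le_mul_left h2 (by positivity)

end components

section gridgeo

variable {n : ℕ}

/-- vertex `v` lies in the plaquette with lower corner `p` -/
def inP (p v : Fin n × Fin n) : Prop :=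
  p.1.val ≤ v.1.val ∧ v.1.val ≤ p.1.val + 1 ∧ p.2.val ≤ v.2.val ∧ v.2.val ≤ p.2.val + 1

/-- king adjacency of plaquettes -/
def shr (p q : Fin n × Fin n) : Prop :=
  p.1.val ≤ q.1.val + 1 ∧ q.1.val ≤ p.1.val + 1 ∧ p.2.val ≤ q.2.val + 1 ∧ q.2.val ≤ p.2.val + 1

theorem shr_refl (p : Fin n × Fin n) : shr p p := by unfold shr; omega
theorem shr_symm (p q : Fin n × Fin n) (h : shr p q) : shr q p := by unfold shr at *; omega
theorem shr_of_inP {p q v : Fin n × Fin n} (h : inP p v) (h' : inP q v) : shr p q := by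
  unfold shr inP at *; omega

theorem box_card (a b k : ℕ) (Q : Finset (Fin n × Fin n))
    (hQ : ∀ q ∈ Q, a ≤ q.1.val ∧ q.1.val < a + k ∧ b ≤ q.2.val ∧ q.2.val < b + k) :
    Q.card ≤ k * k := by
  have h : Q.card ≤ (Finset.Ico a (a+k) ×ˢ Finset.Ico b (b+k)).card := by
    refine Finset.card_le_card_of_injOn (fun q => (q.1.val, q.2.val)) ?_ ?_
    · intro q hq
      have := hQ q hq
      simp only [Finset.coe_product, Set.mem_prod, Finset.mem_coe, Finset.mem_Ico]
      omega
    · intro q _ q' _ h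
      simp only [Prod.mk.injEq] at h
      exact Prod.ext (Fin.ext h.1) (Fin.ext h.2)
  simpa [Finset.card_product] using h

theorem shr_card (p : Fin n × Fin n) : (Finset.univ.filter (fun q => shr p q)).card ≤ 9 := by
  refine box_card (p.1.val - 1) (p.2.val - 1) 3 _ fun q hq => ?_
  simp only [Finset.mem_filter, Finset.mem_univ, true_and] at hq
  unfold shr at hq
  omega

theorem inP_card (v : Fin n × Fin n) : (Finset.univ.filter (fun p => inP p v)).card ≤ 4 := by
  refine box_card (v.1.val - 1) (v.2.val - 1) 2 _ fun q hq => ?_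
  simp only [Finset.mem_filter, Finset.mem_univ, true_and] at hq
  unfold inP at hq
  omega

theorem inP_card' (p : Fin n × Fin n) : (Finset.univ.filter (fun v => inP p v)).card ≤ 4 := by
  refine box_card (p.1.val) (p.2.val) 2 _ fun q hq => ?_
  simp only [Finset.mem_filter, Finset.mem_univ, true_and] at hq
  unfold inP at hq
  omega

theorem grid_adj (p q : Fin n × Fin n) : (grid n).Adj p q ↔
    (p.1 = q.1 ∧ p.2.val + 1 = q.2.val) ∨ (p.2 = q.2 ∧ p.1.val + 1 = q.1.val) ∨
    (q.1 = p.1 ∧ q.2.val + 1 = p.2.val) ∨ (q.2 = p.2 ∧ q.1.val + 1 = p.1.val) := by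
  unfold grid
  rw [SimpleGraph.fromRel_adj]
  constructor
  · tauto
  · intro h
    refine ⟨?_, by tauto⟩
    rintro rfl
    omega

theorem adj_plaq {u v : Fin n × Fin n} (h : (grid n).Adj u v) : ∃ p, inP p u ∧ inP p v := by
  rw [grid_adj] at h
  rcases h with h | h | h | h
  · exact ⟨u, by unfold inP; omega, by unfold inP; have := congrArg Fin.val h.1; omega⟩
  · exact ⟨u, by unfold inP; omega, by unfold inP; have := congrArg Fin.val h.1; omega⟩
  · exact ⟨v, by unfold inP; have := congrArg Fin.val h.1; omega, by unfold inP; omega⟩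
  · exact ⟨v, by unfold inP; have := congrArg Fin.val h.1; omega, by unfold inP; omega⟩

theorem fin_const {α : Type*} (g : Fin n → α)
    (h : ∀ a b : Fin n, a.val + 1 = b.val → g a = g b) (a b : Fin n) : g a = g b := by
  have key : ∀ k : ℕ, ∀ hk : k < n, g ⟨k, hk⟩ = g ⟨0, by omega⟩ := by
    intro k
    induction k with
    | zero => intro hk; rfl
    | succ k ih =>
      intro hk
      rw [← ih (by omega)]
      exact (h _ _ rfl).symm
  exact (key a.val a.isLt).trans (key b.val b.isLt).symm

theorem grid_const {α : Type*} (g : Fin n × Fin n → α)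
    (h : ∀ u v, (grid n).Adj u v → g u = g v) (u v : Fin n × Fin n) : g u = g v := by
  have h1 : g (u.1, u.2) = g (u.1, v.2) :=
    fin_const (fun j => g (u.1, j)) (fun a b hab => h _ _ (by rw [grid_adj]; left; exact ⟨rfl, hab⟩))
      u.2 v.2
  have h2 : g (u.1, v.2) = g (v.1, v.2) :=
    fin_const (fun j => g (j, v.2))
      (fun a b hab => h _ _ (by rw [grid_adj]; right; left; exact ⟨rfl, hab⟩)) u.1 v.1
  exact h1.trans h2

/-- `f` is a primitive (mod 2) of the edge set `X` -/
def IsPrim (X : Finset (Sym2 (Fin n × Fin n))) (f : Fin n × Fin n → ZMod 2) : Prop :=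
  ∀ u v, (grid n).Adj u v → f u + f v = if s(u, v) ∈ X then 1 else 0

/-- indicator of an edge, on natural coordinates -/
def eX (X : Finset (Sym2 (Fin n × Fin n))) (i j i' j' : ℕ) : ZMod 2 :=
  if h : i < n ∧ j < n ∧ i' < n ∧ j' < n then
    (if s(((⟨i, h.1⟩, ⟨j, h.2.1⟩) : Fin n × Fin n), (⟨i', h.2.2.1⟩, ⟨j', h.2.2.2⟩)) ∈ X then 1 else 0)
  else 0

theorem prim_exists (X : Finset (Sym2 (Fin n × Fin n)))
    (hX : ∀ i j : ℕ, i + 1 < n → j + 1 < n →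
      eX X i j i (j+1) + eX X (i+1) j (i+1) (j+1) + eX X i j (i+1) j
        + eX X i (j+1) (i+1) (j+1) = 0) : ∃ f, IsPrim X f := by
  let f : ℕ → ℕ → ZMod 2 := fun i j =>
    ∑ b ∈ Finset.range j, eX X 0 b 0 (b+1) + ∑ a ∈ Finset.range i, eX X a j (a+1) j
  have hv : ∀ i j, f i j + f (i+1) j = eX X i j (i+1) j := by
    intro i j
    simp only [f, Finset.sum_range_succ]
    generalize ∑ b ∈ Finset.range j, eX X 0 b 0 (b+1) = x
    generalize ∑ a ∈ Finset.range i, eX X a j (a+1) j = y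
    generalize eX X i j (i+1) j = z
    revert x y z; decide
  have hh : ∀ i j, i < n → j + 1 < n → f i j + f i (j+1) = eX X i j i (j+1) := by
    intro i j
    induction i with
    | zero =>
      intro _ _
      simp only [f, Finset.sum_range_succ, Finset.sum_range_zero]
      generalize ∑ b ∈ Finset.range j, eX X 0 b 0 (b+1) = x
      generalize eX X 0 j 0 (j+1) = z
      revert x z; decide
    | succ i ih =>
      intro hi hj
      have h1 := ih (by omega) hj
      have h2 := hv i j
      have h3 := hv i (j+1)
      have h4 := hX i j hi hj
      revert h1 h2 h3 h4
      generalize f i j = a1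
      generalize f i (j+1) = a2
      generalize f (i+1) j = a3
      generalize f (i+1) (j+1) = a4
      generalize eX X i j i (j+1) = b1
      generalize eX X (i+1) j (i+1) (j+1) = b2
      generalize eX X i j (i+1) j = b3
      generalize eX X i (j+1) (i+1) (j+1) = b4
      intro h1 h2 h3 h4
      subst h1 h2 h3
      revert h4
      revert a1 a2 a3 a4 b2
      decide
  refine ⟨fun u => f u.1.val u.2.val, ?_⟩
  have hor : ∀ u v : Fin n × Fin n, (u.1 = v.1 ∧ u.2.val + 1 = v.2.val) ∨
      (u.2 = v.2 ∧ u.1.val + 1 = v.1.val) →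
      f u.1.val u.2.val + f v.1.val v.2.val = if s(u, v) ∈ X then 1 else 0 := by
    rintro ⟨a, b⟩ ⟨c, d⟩ (⟨h1, h2⟩ | ⟨h1, h2⟩)
    · dsimp only at h1 h2 ⊢
      subst h1
      rw [← h2, hh _ _ a.isLt (by rw [h2]; exact d.isLt)]
      unfold eX
      rw [dif_pos ⟨a.isLt, b.isLt, a.isLt, by rw [h2]; exact d.isLt⟩]
      simp only [h2, Fin.eta]
    · dsimp only at h1 h2 ⊢
      subst h1
      rw [← h2, hv]
      unfold eX
      rw [dif_pos ⟨a.isLt, b.isLt, by rw [h2]; exact c.isLt, b.isLt⟩]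
      simp only [h2, Fin.eta]
  intro u v huv
  rw [grid_adj] at huv
  rcases huv with h | h | h | h
  · exact hor u v (Or.inl h)
  · exact hor u v (Or.inr h)
  · rw [add_comm, Sym2.eq_swap]; exact hor v u (Or.inl h)
  · rw [add_comm, Sym2.eq_swap]; exact hor v u (Or.inr h)

def FreeRow (X : Finset (Sym2 (Fin n × Fin n))) (i : Fin n) : Prop :=
  ∀ j j' : Fin n, s((i, j), (i, j')) ∉ X
def FreeCol (X : Finset (Sym2 (Fin n × Fin n))) (j : Fin n) : Prop :=
  ∀ i i' : Fin n, s((i, j), (i', j)) ∉ X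

theorem prim_norm (X : Finset (Sym2 (Fin n × Fin n))) (h : ∃ f, IsPrim X f)
    (j₀ : Fin n) (hj : FreeCol X j₀) :
    ∃ f, IsPrim X f ∧ ∀ i, FreeRow X i → ∀ j, f (i, j) = 0 := by
  obtain ⟨f, hf⟩ := h
  have h2 : ∀ a b : ZMod 2, a + b = 0 → a = b := by decide
  have hcol : ∀ i i', f (i, j₀) = f (i', j₀) := by
    refine fin_const (fun i => f (i, j₀)) fun a b hab => h2 _ _ ?_
    have := hf (a, j₀) (b, j₀) (by rw [grid_adj]; right; left; exact ⟨rfl, hab⟩)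
    rwa [if_neg (hj a b)] at this
  have hrow : ∀ i, FreeRow X i → ∀ j j', f (i, j) = f (i, j') := by
    intro i hi
    refine fin_const (fun j => f (i, j)) fun a b hab => h2 _ _ ?_
    have := hf (i, a) (i, b) (by rw [grid_adj]; left; exact ⟨rfl, hab⟩)
    rwa [if_neg (hi a b)] at this
  refine ⟨fun u => f u + f (j₀, j₀), ?_, ?_⟩
  · intro u v huv
    rw [← hf u v huv]
    change f u + f (j₀, j₀) + (f v + f (j₀, j₀)) = f u + f v
    generalize f u = a
    generalize f v = b
    generalize f (j₀, j₀) = c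
    revert a b c; decide
  · intro i hi j
    dsimp only
    rw [hrow i hi j j₀, hcol i j₀]
    generalize f (j₀, j₀) = c
    revert c; decide

/-- normalised primitive -/
def nPrim (X : Finset (Sym2 (Fin n × Fin n))) : Fin n × Fin n → ZMod 2 :=
  if h : ∃ f, IsPrim X f ∧ ∀ i, FreeRow X i → ∀ j, f (i, j) = 0 then h.choose else 0

/-- some primitive -/
def aPrim (X : Finset (Sym2 (Fin n × Fin n))) : Fin n × Fin n → ZMod 2 :=
  if h : ∃ f, IsPrim X f then h.choose else 0

/-- bad plaquettes -/
def PA (A : Finset (Fin n × Fin n)) (σ : Fin n × Fin n → Bool) : Finset (Fin n × Fin n) :=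
  Finset.univ.filter (fun p => (∃ a ∈ A, inP p a) ∨
    ∃ u v, (grid n).Adj u v ∧ inP p u ∧ inP p v ∧ σ u ≠ σ v)

/-- disagreement edges of `σ` in plaquettes of `K` -/
def XK (σ : Fin n × Fin n → Bool) (K : Finset (Fin n × Fin n)) : Finset (Sym2 (Fin n × Fin n)) :=
  Finset.univ.filter (fun e => ∃ u v, e = s(u, v) ∧ (grid n).Adj u v ∧ σ u ≠ σ v ∧
    ∃ p ∈ K, inP p u ∧ inP p v)

theorem mem_XK (σ : Fin n × Fin n → Bool) (K : Finset (Fin n × Fin n)) (u v : Fin n × Fin n) :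
    s(u, v) ∈ XK σ K ↔ (grid n).Adj u v ∧ σ u ≠ σ v ∧ ∃ p ∈ K, inP p u ∧ inP p v := by
  simp only [XK, Finset.mem_filter, Finset.mem_univ, true_and]
  constructor
  · rintro ⟨a, b, he, h1, h2, p, hp, h3, h4⟩
    rw [Sym2.eq_iff] at he
    rcases he with ⟨rfl, rfl⟩ | ⟨rfl, rfl⟩
    · exact ⟨h1, h2, p, hp, h3, h4⟩
    · exact ⟨h1.symm, h2.symm, p, hp, h4, h3⟩
  · intro h
    exact ⟨u, v, rfl, h⟩

theorem mem_PA_of {A : Finset (Fin n × Fin n)} {σ : Fin n × Fin n → Bool} {p u v : Fin n × Fin n}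
    (h : (grid n).Adj u v) (hu : inP p u) (hv : inP p v) (hne : σ u ≠ σ v) : p ∈ PA A σ := by
  simp only [PA, Finset.mem_filter, Finset.mem_univ, true_and]
  exact Or.inr ⟨u, v, h, hu, hv, hne⟩

theorem mem_XK_cpt (A : Finset (Fin n × Fin n)) (σ : Fin n × Fin n → Bool) (p₀ : Fin n × Fin n)
    (hp₀ : p₀ ∈ PA A σ) {p u v : Fin n × Fin n} (h : (grid n).Adj u v) (hu : inP p u)
    (hv : inP p v) :
    s(u, v) ∈ XK σ (cpt shr (PA A σ) p₀) ↔ p ∈ cpt shr (PA A σ) p₀ ∧ σ u ≠ σ v := by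
  rw [mem_XK]
  constructor
  · rintro ⟨_, hne, q, hq, hqu, hqv⟩
    exact ⟨cpt_step shr _ _ hp₀ hq (mem_PA_of h hu hv hne) (shr_of_inP hqu hu), hne⟩
  · rintro ⟨hp, hne⟩
    exact ⟨h, hne, p, hp, hu, hv⟩

def zb (b : Bool) : ZMod 2 := if b then 1 else 0

theorem XK_prim (A : Finset (Fin n × Fin n)) (σ : Fin n × Fin n → Bool) (p₀ : Fin n × Fin n)
    (hp₀ : p₀ ∈ PA A σ) : ∃ f, IsPrim (XK σ (cpt shr (PA A σ) p₀)) f := by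
  apply prim_exists
  intro i j hi hj
  set X := XK σ (cpt shr (PA A σ) p₀) with hXdef
  have hi' : i < n := by omega
  have hj' : j < n := by omega
  let p : Fin n × Fin n := (⟨i, hi'⟩, ⟨j, hj'⟩)
  have key : ∀ (a b a' b' : ℕ) (ha : a < n) (hb : b < n) (ha' : a' < n) (hb' : b' < n),
      i ≤ a → a ≤ i + 1 → j ≤ b → b ≤ j + 1 → i ≤ a' → a' ≤ i + 1 → j ≤ b' → b' ≤ j + 1 →
      ((a = a' ∧ b + 1 = b') ∨ (b = b' ∧ a + 1 = a')) →
      eX X a b a' b' = if p ∈ cpt shr (PA A σ) p₀ then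
        zb (σ (⟨a, ha⟩, ⟨b, hb⟩)) + zb (σ (⟨a', ha'⟩, ⟨b', hb'⟩)) else 0 := by
    intro a b a' b' ha hb ha' hb' h1 h2 h3 h4 h5 h6 h7 h8 hadj
    unfold eX
    rw [dif_pos ⟨ha, hb, ha', hb'⟩]
    have := mem_XK_cpt A σ p₀ hp₀ (p := p) (u := (⟨a, ha⟩, ⟨b, hb⟩)) (v := (⟨a', ha'⟩, ⟨b', hb'⟩))
      (by
        rw [grid_adj]
        simp only [Fin.mk.injEq]
        tauto) (by simp only [inP, p]; omega) (by simp only [inP, p]; omega)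
    simp only [hXdef, this]
    by_cases hp : p ∈ cpt shr (PA A σ) p₀
    · simp only [hp, true_and, if_true]
      generalize σ (⟨a, ha⟩, ⟨b, hb⟩) = x
      generalize σ (⟨a', ha'⟩, ⟨b', hb'⟩) = y
      revert x y; decide
    · simp [hp]
  rw [key i j i (j+1) hi' hj' hi' hj (by omega) (by omega) (by omega) (by omega) (by omega)
      (by omega) (by omega) (by omega) (by omega),
    key (i+1) j (i+1) (j+1) hi hj' hi hj (by omega) (by omega) (by omega) (by omega) (by omega)
      (by omega) (by omega) (by omega) (by omega),
    key i j (i+1) j hi' hj' hi hj' (by omega) (by omega) (by omega) (by omega) (by omega)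
      (by omega) (by omega) (by omega) (by omega),
    key i (j+1) (i+1) (j+1) hi' hj hi hj (by omega) (by omega) (by omega) (by omega) (by omega)
      (by omega) (by omega) (by omega) (by omega)]
  split_ifs
  · generalize zb (σ (⟨i, hi'⟩, ⟨j, hj'⟩)) = x
    generalize zb (σ (⟨i, hi'⟩, ⟨j+1, hj⟩)) = y
    generalize zb (σ (⟨i+1, hi⟩, ⟨j, hj'⟩)) = z
    generalize zb (σ (⟨i+1, hi⟩, ⟨j+1, hj⟩)) = w
    revert x y z w; decide
  · decide

end gridgeo

section phase

variable {n : ℕ}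

theorem rows_avoid (T : Finset (Fin n × Fin n)) (i₀ : Fin n) (hT : 2 * T.card + 1 < n) :
    ∃ i : Fin n, i ≠ i₀ ∧ ∀ p ∈ T, ¬ (p.1.val ≤ i.val ∧ i.val ≤ p.1.val + 1) := by
  by_contra hc
  push Not at hc
  have hsub : (Finset.univ : Finset (Fin n)) ⊆ {i₀} ∪ T.biUnion (fun p =>
      Finset.univ.filter (fun i : Fin n => p.1.val ≤ i.val ∧ i.val ≤ p.1.val + 1)) := by
    intro i _
    by_cases h : i = i₀
    · simp [h]
    · obtain ⟨p, hp, h'⟩ := hc i h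
      rw [Finset.mem_union, Finset.mem_biUnion]
      exact Or.inr ⟨p, hp, by simpa using h'⟩
  have h1 := Finset.card_le_card hsub
  have h2 : (T.biUnion (fun p => Finset.univ.filter
      (fun i : Fin n => p.1.val ≤ i.val ∧ i.val ≤ p.1.val + 1))).card ≤ T.card * 2 := by
    refine Finset.card_biUnion_le_card_mul _ _ _ fun p _ => ?_
    have : (Finset.univ.filter (fun i : Fin n => p.1.val ≤ i.val ∧ i.val ≤ p.1.val + 1)).card
        ≤ (Finset.Ico p.1.val (p.1.val + 2)).card := by
      refine Finset.card_le_card_of_injOn (fun i => i.val) ?_ ?_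
      · intro i hi
        simp only [Finset.coe_filter, Finset.mem_univ, true_and, Set.mem_setOf_eq] at hi
        simp only [Finset.coe_Ico, Set.mem_Ico]
        omega
      · intro a _ b _ h
        exact Fin.ext h
    simpa using this
  have h3 := Finset.card_union_le {i₀} (T.biUnion (fun p => Finset.univ.filter
      (fun i : Fin n => p.1.val ≤ i.val ∧ i.val ≤ p.1.val + 1)))
  simp only [Finset.card_univ, Fintype.card_fin, Finset.card_singleton] at h1 h3
  omega

theorem cols_avoid (T : Finset (Fin n × Fin n)) (hn : 0 < n) (hT : 2 * T.card + 1 < n) :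
    ∃ j : Fin n, ∀ p ∈ T, ¬ (p.2.val ≤ j.val ∧ j.val ≤ p.2.val + 1) := by
  have hc : (T.image Prod.swap).card ≤ T.card := Finset.card_image_le
  obtain ⟨j, -, h⟩ := rows_avoid (T.image Prod.swap) ⟨0, hn⟩ (by omega)
  refine ⟨j, fun p hp => ?_⟩
  exact h p.swap (Finset.mem_image_of_mem _ hp)

theorem freeRow_of (σ : Fin n × Fin n → Bool) (K : Finset (Fin n × Fin n)) (i : Fin n)
    (h : ∀ p ∈ K, ¬ (p.1.val ≤ i.val ∧ i.val ≤ p.1.val + 1)) : FreeRow (XK σ K) i := by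
  intro j j' hm
  rw [mem_XK] at hm
  obtain ⟨_, _, p, hp, h1, _⟩ := hm
  exact h p hp ⟨h1.1, h1.2.1⟩

theorem freeCol_of (σ : Fin n × Fin n → Bool) (K : Finset (Fin n × Fin n)) (i : Fin n)
    (h : ∀ p ∈ K, ¬ (p.2.val ≤ i.val ∧ i.val ≤ p.2.val + 1)) : FreeCol (XK σ K) i := by
  intro j j' hm
  rw [mem_XK] at hm
  obtain ⟨_, _, p, hp, h1, _⟩ := hm
  exact h p hp ⟨h1.2.2.1, h1.2.2.2⟩

/-- all components of bad plaquettes are small -/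
def Good (A : Finset (Fin n × Fin n)) (σ : Fin n × Fin n → Bool) : Prop :=
  ∀ p ∈ PA A σ, 100 * (cpt shr (PA A σ) p).card < n

theorem nPrim_spec (A : Finset (Fin n × Fin n)) (σ : Fin n × Fin n → Bool) (hn : 3 ≤ n)
    (hg : Good A σ) (p : Fin n × Fin n) (hp : p ∈ PA A σ) :
    IsPrim (XK σ (cpt shr (PA A σ) p)) (nPrim (XK σ (cpt shr (PA A σ) p))) ∧
    ∀ i, FreeRow (XK σ (cpt shr (PA A σ) p)) i →
      ∀ j, nPrim (XK σ (cpt shr (PA A σ) p)) (i, j) = 0 := by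
  have hs := hg p hp
  obtain ⟨j, hj⟩ := cols_avoid (cpt shr (PA A σ) p) (by omega) (by omega)
  have h := prim_norm _ (XK_prim A σ p hp) j (freeCol_of σ _ j hj)
  unfold nPrim
  rw [dif_pos h]
  exact h.choose_spec

def comps (A : Finset (Fin n × Fin n)) (σ : Fin n × Fin n → Bool) :
    Finset (Finset (Fin n × Fin n)) :=
  (PA A σ).image (cpt shr (PA A σ))

/-- the phase, evaluated at `w` -/
def phs (A : Finset (Fin n × Fin n)) (σ : Fin n × Fin n → Bool) (w : Fin n × Fin n) : ZMod 2 :=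
  zb (σ w) + ∑ K ∈ comps A σ, nPrim (XK σ K) w

theorem phs_const (A : Finset (Fin n × Fin n)) (σ : Fin n × Fin n → Bool) (hn : 3 ≤ n)
    (hg : Good A σ) (u w : Fin n × Fin n) : phs A σ u = phs A σ w := by
  refine grid_const _ (fun u v huv => ?_) u w
  have h2 : ∀ a b : ZMod 2, a + b = 0 → a = b := by decide
  apply h2
  have e : phs A σ u + phs A σ v = (zb (σ u) + zb (σ v)) +
      ∑ K ∈ comps A σ, (nPrim (XK σ K) u + nPrim (XK σ K) v) := by
    unfold phs
    rw [Finset.sum_add_distrib]; ring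
  rw [e]
  have e2 : ∑ K ∈ comps A σ, (nPrim (XK σ K) u + nPrim (XK σ K) v) =
      ∑ K ∈ comps A σ, if s(u, v) ∈ XK σ K then 1 else 0 := by
    refine Finset.sum_congr rfl fun K hK => ?_
    simp only [comps, Finset.mem_image] at hK
    obtain ⟨p, hp, rfl⟩ := hK
    exact (nPrim_spec A σ hn hg p hp).1 u v huv
  rw [e2]
  by_cases hne : σ u = σ v
  · rw [Finset.sum_eq_zero, hne]
    · generalize zb (σ v) = x
      revert x; decide
    · intro K _
      rw [if_neg]
      rw [mem_XK]
      exact fun h => h.2.1 hne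
  · obtain ⟨p, hpu, hpv⟩ := adj_plaq huv
    have hp : p ∈ PA A σ := mem_PA_of huv hpu hpv hne
    rw [Finset.sum_eq_single (cpt shr (PA A σ) p)]
    · rw [if_pos ((mem_XK_cpt A σ p hp huv hpu hpv).2 ⟨cpt_self _ _ _, hne⟩)]
      revert hne
      generalize σ u = x
      generalize σ v = y
      revert x y; decide
    · intro K hK hKne
      simp only [comps, Finset.mem_image] at hK
      obtain ⟨q, hq, rfl⟩ := hK
      rw [if_neg]
      intro h
      have := (mem_XK_cpt A σ q hq huv hpu hpv).1 h
      exact hKne (cpt_eq shr shr_symm _ _ _ this.1).symm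
    · intro h
      exact absurd (Finset.mem_image_of_mem _ hp) h

theorem PA_agree (A : Finset (Fin n × Fin n)) (σ σ' : Fin n × Fin n → Bool) (v : Fin n × Fin n)
    (hag : ∀ u, u ≠ v → σ u = σ' u) (q : Fin n × Fin n) (hq : ¬ inP q v) :
    q ∈ PA A σ ↔ q ∈ PA A σ' := by
  simp only [PA, Finset.mem_filter, Finset.mem_univ, true_and]
  refine or_congr Iff.rfl (exists_congr fun a => exists_congr fun b => ?_)
  refine and_congr_right fun _ => and_congr_right fun ha => and_congr_right fun hb => ?_
  rw [hag a (by rintro rfl; exact hq ha), hag b (by rintro rfl; exact hq hb)]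

/-- plaquettes near `v` -/
def nearP (v : Fin n × Fin n) : Finset (Fin n × Fin n) :=
  Finset.univ.filter (fun q => ∃ p, inP p v ∧ shr p q)

theorem nearP_card (v : Fin n × Fin n) : (nearP v).card ≤ 16 := by
  refine box_card (v.1.val - 2) (v.2.val - 2) 4 _ fun q hq => ?_
  simp only [nearP, Finset.mem_filter, Finset.mem_univ, true_and] at hq
  obtain ⟨p, h1, h2⟩ := hq
  unfold shr at h2
  unfold inP at h1
  omega

theorem XK_agree (σ σ' : Fin n × Fin n → Bool) (v : Fin n × Fin n)
    (hag : ∀ u, u ≠ v → σ u = σ' u) (K : Finset (Fin n × Fin n)) (hK : Disjoint K (nearP v)) :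
    XK σ K = XK σ' K := by
  ext e
  simp only [XK, Finset.mem_filter, Finset.mem_univ, true_and]
  refine exists_congr fun a => exists_congr fun b => ?_
  refine and_congr_right fun _ => and_congr_right fun _ => ?_
  have hk : ∀ p ∈ K, ∀ u, inP p u → u ≠ v := by
    rintro p hp u hu rfl
    refine Finset.disjoint_left.1 hK hp ?_
    simp only [nearP, Finset.mem_filter, Finset.mem_univ, true_and]
    exact ⟨p, hu, shr_refl p⟩
  constructor
  · rintro ⟨h, p, hp, ha, hb⟩
    refine ⟨?_, p, hp, ha, hb⟩
    rwa [← hag a (hk p hp a ha), ← hag b (hk p hp b hb)]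
  · rintro ⟨h, p, hp, ha, hb⟩
    refine ⟨?_, p, hp, ha, hb⟩
    rwa [hag a (hk p hp a ha), hag b (hk p hp b hb)]

theorem comps_agree (A : Finset (Fin n × Fin n)) (σ σ' : Fin n × Fin n → Bool) (v : Fin n × Fin n)
    (hag : ∀ u, u ≠ v → σ u = σ' u) (K : Finset (Fin n × Fin n)) (hK : Disjoint K (nearP v))
    (h : K ∈ comps A σ) : K ∈ comps A σ' := by
  simp only [comps, Finset.mem_image] at h ⊢
  obtain ⟨p, hp, rfl⟩ := h
  have key : ∀ k ∈ cpt shr (PA A σ) p, ∀ q, shr k q → (q ∈ PA A σ ↔ q ∈ PA A σ') := by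
    intro k hk q hkq
    apply PA_agree A σ σ' v hag
    intro hq
    refine Finset.disjoint_left.1 hK hk ?_
    simp only [nearP, Finset.mem_filter, Finset.mem_univ, true_and]
    exact ⟨q, hq, shr_symm _ _ hkq⟩
  exact ⟨p, (key p (cpt_self _ _ _) p (shr_refl p)).1 hp, cpt_congr shr shr_refl _ _ p hp key⟩

/-- plaquettes in components near `v` -/
def tch (A : Finset (Fin n × Fin n)) (v : Fin n × Fin n) (τ : Fin n × Fin n → Bool) :
    Finset (Fin n × Fin n) :=
  (nearP v ∩ PA A τ).biUnion (cpt shr (PA A τ))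

theorem tch_card (A : Finset (Fin n × Fin n)) (v : Fin n × Fin n) (τ : Fin n × Fin n → Bool)
    (hτ : Good A τ) : (tch A v τ).card ≤ 16 * (n / 100) := by
  refine (Finset.card_biUnion_le_card_mul _ _ (n / 100) fun p hp => ?_).trans
    (Nat.mul_le_mul_right _ ?_)
  · have := hτ p (Finset.mem_inter.1 hp).2
    omega
  · exact (Finset.card_le_card Finset.inter_subset_left).trans (nearP_card v)

theorem phs_stable (A : Finset (Fin n × Fin n)) (σ σ' : Fin n × Fin n → Bool) (v : Fin n × Fin n)
    (hn : 3 ≤ n) (hg : Good A σ) (hg' : Good A σ')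
    (hag : ∀ u, u ≠ v → σ u = σ' u) (w : Fin n × Fin n) : phs A σ w = phs A σ' w := by
  have hTT : 2 * (tch A v σ ∪ tch A v σ').card + 1 < n := by
    have h1 := tch_card A v σ hg
    have h2 := tch_card A v σ' hg'
    have h3 := Finset.card_union_le (tch A v σ) (tch A v σ')
    omega
  obtain ⟨i, hiv, hi⟩ := rows_avoid (tch A v σ ∪ tch A v σ') v.1 hTT
  rw [phs_const A σ hn hg w (i, i), phs_const A σ' hn hg' w (i, i)]
  have red : ∀ τ, Good A τ → tch A v τ ⊆ tch A v σ ∪ tch A v σ' →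
      ∑ K ∈ comps A τ, nPrim (XK τ K) (i, i) =
      ∑ K ∈ (comps A τ).filter (fun K => Disjoint K (nearP v)), nPrim (XK τ K) (i, i) := by
    intro τ hτ hsub
    symm
    refine Finset.sum_filter_of_ne fun K hK hne => ?_
    by_contra hd
    apply hne
    simp only [comps, Finset.mem_image] at hK
    obtain ⟨p, hp, rfl⟩ := hK
    rw [Finset.not_disjoint_iff] at hd
    obtain ⟨q, hq1, hq2⟩ := hd
    refine (nPrim_spec A τ hn hτ p hp).2 i (freeRow_of τ _ i fun k hk => hi k (hsub ?_)) i
    rw [tch, Finset.mem_biUnion]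
    refine ⟨q, Finset.mem_inter.2 ⟨hq2, cpt_subset _ _ _ hp hq1⟩, ?_⟩
    rwa [cpt_eq shr shr_symm _ _ _ hq1]
  unfold phs
  rw [red σ hg Finset.subset_union_left, red σ' hg' Finset.subset_union_right,
    hag (i, i) (fun h => hiv (congrArg Prod.fst h))]
  refine congrArg (fun x => zb (σ' (i, i)) + x) ?_
  have hfe : (comps A σ).filter (fun K => Disjoint K (nearP v)) =
      (comps A σ').filter (fun K => Disjoint K (nearP v)) := by
    ext K
    simp only [Finset.mem_filter]
    exact ⟨fun h => ⟨comps_agree A σ σ' v hag K h.2 h.1, h.2⟩,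
      fun h => ⟨comps_agree A σ' σ v (fun u hu => (hag u hu).symm) K h.2 h.1, h.2⟩⟩
  rw [hfe]
  refine Finset.sum_congr rfl fun K hK => ?_
  rw [XK_agree σ σ' v hag K (Finset.mem_filter.1 hK).2]

/-- global flip -/
def gfl (σ : Fin n × Fin n → Bool) : Fin n × Fin n → Bool := fun u => !(σ u)

theorem PA_gfl (A : Finset (Fin n × Fin n)) (σ : Fin n × Fin n → Bool) :
    PA A (gfl σ) = PA A σ := by
  simp [PA, gfl]

theorem XK_gfl (σ : Fin n × Fin n → Bool) (K : Finset (Fin n × Fin n)) :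
    XK (gfl σ) K = XK σ K := by
  simp [XK, gfl]

theorem Good_gfl (A : Finset (Fin n × Fin n)) (σ : Fin n × Fin n → Bool) :
    Good A (gfl σ) ↔ Good A σ := by
  unfold Good; rw [PA_gfl]

theorem phs_gfl (A : Finset (Fin n × Fin n)) (σ : Fin n × Fin n → Bool) (w : Fin n × Fin n) :
    phs A (gfl σ) w = phs A σ w + 1 := by
  unfold phs comps
  rw [PA_gfl]
  simp only [XK_gfl]
  rw [add_right_comm]
  congr 1
  simp only [gfl]
  generalize σ w = x
  revert x; decide

theorem Good_of_mem (A : Finset (Fin n × Fin n)) (σ σ' : Fin n × Fin n → Bool)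
    (v : Fin n × Fin n) (hv : v ∈ A) (hag : ∀ u, u ≠ v → σ u = σ' u) (hg : Good A σ) :
    Good A σ' := by
  have : PA A σ' = PA A σ := by
    ext q
    by_cases hq : inP q v
    · simp only [PA, Finset.mem_filter, Finset.mem_univ, true_and]
      exact ⟨fun _ => Or.inl ⟨v, hv, hq⟩, fun _ => Or.inl ⟨v, hv, hq⟩⟩
    · exact (PA_agree A σ σ' v hag q hq).symm
  unfold Good
  rw [this]
  exact hg

end phase

section peierls

variable {n : ℕ}

/-- flip `σ` where `f = 1` -/
def flp (σ : Fin n × Fin n → Bool) (f : Fin n × Fin n → ZMod 2) : Fin n × Fin n → Bool :=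
  fun u => if f u = 1 then !(σ u) else σ u

theorem flp_flp (σ : Fin n × Fin n → Bool) (f : Fin n × Fin n → ZMod 2) :
    flp (flp σ f) f = σ := by
  funext u
  unfold flp
  split_ifs <;> simp

theorem ham_flp (σ : Fin n × Fin n → Bool) (K : Finset (Fin n × Fin n))
    (f : Fin n × Fin n → ZMod 2) (hf : IsPrim (XK σ K) f) :
    ham (grid n) (flp σ f) = ham (grid n) σ + 2 * (XK σ K).card := by
  have hsub : XK σ K ⊆ (grid n).edgeFinset := by
    intro e he
    induction e using Sym2.ind with
    | _ u v =>
      rw [mem_XK] at he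
      simpa using he.1
  have h1 : ham (grid n) (flp σ f) = ∑ e ∈ (grid n).edgeFinset,
      (Sym2.lift ⟨fun u v => spinVal (σ u) * spinVal (σ v), fun u v => mul_comm _ _⟩ e
        + if e ∈ XK σ K then 2 else 0) := by
    unfold ham
    refine Finset.sum_congr rfl fun e he => ?_
    induction e using Sym2.ind with
    | _ u v =>
      have hadj : (grid n).Adj u v := by simpa using he
      have hp := hf u v hadj
      simp only [Sym2.lift_mk]
      by_cases hX : s(u, v) ∈ XK σ K
      · rw [if_pos hX] at hp ⊢
        have hne := ((mem_XK σ K u v).1 hX).2.1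
        have h01 : (f u = 1 ∧ f v = 0) ∨ (f u = 0 ∧ f v = 1) := by
          revert hp
          generalize f u = a
          generalize f v = b
          revert a b; decide
        unfold flp
        rcases h01 with ⟨ha, hb⟩ | ⟨ha, hb⟩ <;> rw [ha, hb] <;>
        · revert hne
          generalize σ u = x
          generalize σ v = y
          cases x <;> cases y <;> simp [spinVal] <;> norm_num
      · rw [if_neg hX] at hp ⊢
        have h01 : (f u = 1 ∧ f v = 1) ∨ (f u = 0 ∧ f v = 0) := by
          revert hp
          generalize f u = a
          generalize f v = b
          revert a b; decide
        unfold flp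
        rcases h01 with ⟨ha, hb⟩ | ⟨ha, hb⟩ <;> rw [ha, hb] <;>
        · generalize σ u = x
          generalize σ v = y
          cases x <;> cases y <;> simp [spinVal]
  rw [h1, Finset.sum_add_distrib]
  unfold ham
  congr 1
  rw [← Finset.sum_filter, Finset.filter_mem_eq_inter, Finset.inter_eq_right.2 hsub]
  simp [mul_comm]

theorem XK_card_lower (A : Finset (Fin n × Fin n)) (σ : Fin n × Fin n → Bool)
    (p₀ : Fin n × Fin n) (hp₀ : p₀ ∈ PA A σ) :
    (cpt shr (PA A σ) p₀).card ≤ A.card * 4 + (XK σ (cpt shr (PA A σ) p₀)).card * 4 := by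
  set K := cpt shr (PA A σ) p₀ with hK
  have hsub : K ⊆ A.biUnion (fun a => Finset.univ.filter (fun p => inP p a)) ∪
      (XK σ K).biUnion (fun e => Finset.univ.filter (fun p => inP p e.out.1)) := by
    intro p hp
    have hpA : p ∈ PA A σ := cpt_subset _ _ _ hp₀ hp
    simp only [PA, Finset.mem_filter, Finset.mem_univ, true_and] at hpA
    rw [Finset.mem_union, Finset.mem_biUnion, Finset.mem_biUnion]
    rcases hpA with ⟨a, ha, hpa⟩ | ⟨u, v, huv, hu, hv, hne⟩
    · exact Or.inl ⟨a, ha, by simpa using hpa⟩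
    · right
      refine ⟨s(u, v), (mem_XK σ K u v).2 ⟨huv, hne, p, hp, hu, hv⟩, ?_⟩
      simp only [Finset.mem_filter, Finset.mem_univ, true_and]
      have := Sym2.out_fst_mem s(u, v)
      rw [Sym2.mem_iff] at this
      rcases this with h | h <;> rw [h] <;> assumption
  refine (Finset.card_le_card hsub).trans ((Finset.card_union_le _ _).trans (Nat.add_le_add ?_ ?_))
  · exact Finset.card_biUnion_le_card_mul _ _ _ fun a _ => inP_card a
  · exact Finset.card_biUnion_le_card_mul _ _ _ fun a _ => inP_card _

/-- all vertex pairs inside plaquettes of `K` -/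
def EK (K : Finset (Fin n × Fin n)) : Finset (Sym2 (Fin n × Fin n)) :=
  K.biUnion (fun p => ((Finset.univ.filter (fun v => inP p v)) ×ˢ
    (Finset.univ.filter (fun v => inP p v))).image (fun x => s(x.1, x.2)))

theorem EK_card (K : Finset (Fin n × Fin n)) : (EK K).card ≤ K.card * 16 := by
  refine Finset.card_biUnion_le_card_mul _ _ _ fun p _ => Finset.card_image_le.trans ?_
  rw [Finset.card_product]
  exact Nat.mul_le_mul (inP_card' p) (inP_card' p)

theorem XK_sub_EK (σ : Fin n × Fin n → Bool) (K : Finset (Fin n × Fin n)) : XK σ K ⊆ EK K := by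
  intro e he
  simp only [XK, Finset.mem_filter, Finset.mem_univ, true_and] at he
  obtain ⟨u, v, rfl, _, _, p, hp, hu, hv⟩ := he
  unfold EK
  rw [Finset.mem_biUnion]
  refine ⟨p, hp, Finset.mem_image.2 ⟨(u, v), ?_, rfl⟩⟩
  simp [hu, hv]

/-- full partition function -/
def ZZ (n : ℕ) (β : ℝ) : ℝ := ∑ σ : Fin n × Fin n → Bool, exp (β * ham (grid n) σ)

theorem peierls_one (β : ℝ) (hβ : 0 ≤ β) (A K : Finset (Fin n × Fin n))
    (hA : 8 * A.card ≤ K.card) :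
    ∑ σ ∈ Finset.univ.filter (fun σ : Fin n × Fin n → Bool => K ∈ comps A σ),
      exp (β * ham (grid n) σ) ≤ 2 ^ (16 * K.card) * exp (-(β * K.card / 4)) * ZZ n β := by
  set B := Finset.univ.filter (fun σ : Fin n × Fin n → Bool => K ∈ comps A σ) with hB
  let Φ : (Fin n × Fin n → Bool) → Finset (Sym2 (Fin n × Fin n)) × (Fin n × Fin n → Bool) :=
    fun σ => (XK σ K, flp σ (aPrim (XK σ K)))
  have hinj : Set.InjOn Φ B := by
    intro σ _ σ' _ h
    simp only [Φ, Prod.mk.injEq] at h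
    obtain ⟨h1, h2⟩ := h
    rw [← h1] at h2
    rw [← flp_flp σ (aPrim (XK σ K)), h2, flp_flp]
  have hstep : ∀ σ ∈ B, exp (β * ham (grid n) σ) ≤
      exp (-(β * K.card / 4)) * exp (β * ham (grid n) (Φ σ).2) := by
    intro σ hσ
    simp only [hB, Finset.mem_filter, Finset.mem_univ, true_and, comps, Finset.mem_image] at hσ
    obtain ⟨p, hp, hpK⟩ := hσ
    have hprim : IsPrim (XK σ K) (aPrim (XK σ K)) := by
      have := XK_prim A σ p hp
      rw [hpK] at this
      unfold aPrim
      rw [dif_pos this]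
      exact this.choose_spec
    have hlow := XK_card_lower A σ p hp
    rw [hpK] at hlow
    simp only [Φ]
    rw [ham_flp σ K _ hprim, ← exp_add, exp_le_exp]
    have hc : (K.card : ℝ) ≤ 8 * (XK σ K).card := by
      have : K.card ≤ 8 * (XK σ K).card := by omega
      exact_mod_cast this
    nlinarith [mul_le_mul_of_nonneg_left hc hβ]
  calc ∑ σ ∈ B, exp (β * ham (grid n) σ)
      ≤ ∑ σ ∈ B, exp (-(β * K.card / 4)) * exp (β * ham (grid n) (Φ σ).2) :=
        Finset.sum_le_sum hstep
    _ = exp (-(β * K.card / 4)) * ∑ y ∈ B.image Φ, exp (β * ham (grid n) y.2) := by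
        rw [← Finset.mul_sum, Finset.sum_image hinj]
    _ ≤ exp (-(β * K.card / 4)) *
        ∑ y ∈ (EK K).powerset ×ˢ (Finset.univ : Finset (Fin n × Fin n → Bool)),
          exp (β * ham (grid n) y.2) := by
        refine mul_le_mul_of_nonneg_left (Finset.sum_le_sum_of_subset_of_nonneg ?_ ?_)
          (exp_pos _).le
        · intro y hy
          rw [Finset.mem_image] at hy
          obtain ⟨σ, _, rfl⟩ := hy
          rw [Finset.mem_product]
          exact ⟨Finset.mem_powerset.2 (XK_sub_EK σ K), Finset.mem_univ _⟩
        · intro y _ _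
          exact (exp_pos _).le
    _ = exp (-(β * K.card / 4)) * (2 ^ (EK K).card * ZZ n β) := by
        rw [Finset.sum_product]
        dsimp only
        rw [Finset.sum_const, Finset.card_powerset, nsmul_eq_mul]
        unfold ZZ
        push_cast
        rfl
    _ ≤ exp (-(β * K.card / 4)) * (2 ^ (16 * K.card) * ZZ n β) := by
        have hZ : 0 ≤ ZZ n β := Finset.sum_nonneg fun σ _ => (exp_pos _).le
        refine mul_le_mul_of_nonneg_left (mul_le_mul_of_nonneg_right ?_ hZ) (exp_pos _).le
        exact pow_le_pow_right₀ (by norm_num) (by have := EK_card K; omega)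
    _ = _ := by ring

section animgen
variable {P : Type*} [Fintype P]

/-- connected sets of size `l` containing `p` -/
def cset (r : P → P → Prop) (p : P) (l : ℕ) : Finset (Finset P) :=
  Finset.univ.filter (fun K : Finset P => K.card = l ∧ ∃ Y : Finset P, p ∈ Y ∧ cpt r Y p = K)

theorem mem_cset (r : P → P → Prop) (p : P) (l : ℕ) (K : Finset P) :
    K ∈ cset r p l ↔ K.card = l ∧ ∃ Y : Finset P, p ∈ Y ∧ cpt r Y p = K := by
  unfold cset
  rw [Finset.mem_filter]
  exact ⟨fun h => h.2, fun h => ⟨Finset.mem_univ _, h⟩⟩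

theorem cset_card (r : P → P → Prop) (hrefl : ∀ a, r a a) (d : ℕ)
    (hd : ∀ a, (Finset.univ.filter (fun b => r a b)).card ≤ d) (p : P) (l : ℕ) :
    (cset r p l).card ≤ 2 ^ (d * l) := cpt_count r hrefl d hd p l

end animgen

/-- connected plaquette sets of size `l` -/
def anim (n l : ℕ) : Finset (Finset (Fin n × Fin n)) :=
  (Finset.univ : Finset (Fin n × Fin n)).biUnion (fun p => cset shr p l)

theorem mem_anim (n l : ℕ) (K : Finset (Fin n × Fin n)) : K ∈ anim n l ↔
    K.card = l ∧ ∃ p, ∃ Y : Finset (Fin n × Fin n), p ∈ Y ∧ cpt shr Y p = K := by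
  unfold anim
  rw [Finset.mem_biUnion]
  constructor
  · rintro ⟨p, _, h⟩
    rw [mem_cset] at h
    exact ⟨h.1, p, h.2⟩
  · rintro ⟨h, p, h2⟩
    exact ⟨p, Finset.mem_univ _, (mem_cset _ _ _ _).2 ⟨h, h2⟩⟩

theorem anim_card (n l : ℕ) : (anim n l).card ≤ (n * n) * 2 ^ (9 * l) := by
  unfold anim
  refine Finset.card_biUnion_le.trans ?_
  refine (Finset.sum_le_card_nsmul _ _ (2 ^ (9 * l))
    (fun p _ => cset_card shr shr_refl 9 shr_card p l)).trans ?_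
  rw [smul_eq_mul, Finset.card_univ, Fintype.card_prod, Fintype.card_fin]

theorem peierls (β : ℝ) (hβ : 104 ≤ β) (A : Finset (Fin n × Fin n)) (hA : 800 * A.card ≤ n) :
    ∑ σ ∈ Finset.univ.filter (fun σ : Fin n × Fin n → Bool => ¬ Good A σ),
      exp (β * ham (grid n) σ) ≤
      ((n * n + 1 : ℕ) : ℝ) * ((n * n : ℕ) : ℝ) * exp (-(n / 100 : ℝ)) * ZZ n β := by
  have hZ : 0 ≤ ZZ n β := Finset.sum_nonneg fun σ _ => (exp_pos _).le
  set R := (Finset.range (n * n + 1)).filter (fun l => n ≤ 100 * l) with hR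
  have h1 : ∑ σ ∈ Finset.univ.filter (fun σ : Fin n × Fin n → Bool => ¬ Good A σ),
      exp (β * ham (grid n) σ) ≤ ∑ σ : Fin n × Fin n → Bool, ∑ l ∈ R, ∑ K ∈ anim n l,
        if K ∈ comps A σ then exp (β * ham (grid n) σ) else 0 := by
    have hnn : ∀ (σ : Fin n × Fin n → Bool) (K : Finset (Fin n × Fin n)),
        0 ≤ if K ∈ comps A σ then exp (β * ham (grid n) σ) else 0 := by
      intro σ K; split_ifs
      · exact (exp_pos _).le
      · exact le_rfl
    rw [Finset.sum_filter]
    refine Finset.sum_le_sum fun σ _ => ?_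
    by_cases hg : Good A σ
    · rw [if_neg (not_not.2 hg)]
      exact Finset.sum_nonneg fun l _ => Finset.sum_nonneg fun K _ => hnn σ K
    rw [if_pos hg]
    unfold Good at hg
    push Not at hg
    obtain ⟨p, hp, hle⟩ := hg
    set K := cpt shr (PA A σ) p with hK
    have hKc : K ∈ comps A σ := Finset.mem_image_of_mem _ hp
    have hKa : K ∈ anim n K.card := by
      rw [mem_anim]
      exact ⟨rfl, p, PA A σ, hp, rfl⟩
    have hKR : K.card ∈ R := by
      rw [hR, Finset.mem_filter, Finset.mem_range]
      have := Finset.card_le_univ K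
      simp only [Fintype.card_prod, Fintype.card_fin] at this
      omega
    calc exp (β * ham (grid n) σ) = if K ∈ comps A σ then exp (β * ham (grid n) σ) else 0 := by
          rw [if_pos hKc]
      _ ≤ ∑ K' ∈ anim n K.card, if K' ∈ comps A σ then exp (β * ham (grid n) σ) else 0 :=
          Finset.single_le_sum
            (f := fun K' => if K' ∈ comps A σ then exp (β * ham (grid n) σ) else 0)
            (fun K' _ => hnn σ K') hKa
      _ ≤ _ := Finset.single_le_sum
            (f := fun l => ∑ K' ∈ anim n l, if K' ∈ comps A σ then exp (β * ham (grid n) σ) else 0)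
            (fun l _ => Finset.sum_nonneg fun K' _ => hnn σ K') hKR
  refine h1.trans ?_
  rw [Finset.sum_comm]
  have h2 : ∀ l ∈ R, ∑ σ : Fin n × Fin n → Bool, ∑ K ∈ anim n l,
        (if K ∈ comps A σ then exp (β * ham (grid n) σ) else 0)
        ≤ ((n * n : ℕ) : ℝ) * exp (-(n / 100 : ℝ)) * ZZ n β := by
    intro l hl
    rw [hR, Finset.mem_filter] at hl
    rw [Finset.sum_comm]
    have h3 : ∀ K ∈ anim n l, ∑ σ : Fin n × Fin n → Bool,
        (if K ∈ comps A σ then exp (β * ham (grid n) σ) else 0) ≤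
        2 ^ (16 * l) * exp (-(β * l / 4)) * ZZ n β := by
      intro K hK
      rw [mem_anim] at hK
      rw [← Finset.sum_filter]
      have := peierls_one β (by linarith) A K (by omega)
      rwa [hK.1] at this
    refine (Finset.sum_le_card_nsmul _ _ _ h3).trans ?_
    rw [nsmul_eq_mul]
    have h4 : ((anim n l).card : ℝ) ≤ ((n * n : ℕ) : ℝ) * 2 ^ (9 * l) := by
      exact_mod_cast anim_card n l
    have h5 : (2:ℝ) ^ (9 * l) * (2 ^ (16 * l) * exp (-(β * l / 4))) ≤ exp (-(n / 100 : ℝ)) := by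
      have h2e : (2:ℝ) ≤ exp 1 := by
        have := add_one_le_exp (1:ℝ)
        linarith
      calc (2:ℝ) ^ (9 * l) * (2 ^ (16 * l) * exp (-(β * l / 4)))
          = 2 ^ (25 * l) * exp (-(β * l / 4)) := by
            rw [← mul_assoc, ← pow_add]; congr 2; ring
        _ ≤ (exp 1) ^ (25 * l) * exp (-(β * l / 4)) :=
            mul_le_mul_of_nonneg_right (pow_le_pow_left₀ (by norm_num) h2e _) (exp_pos _).le
        _ = exp (25 * l - β * l / 4) := by
            rw [← exp_nat_mul, ← exp_add]; congr 1; push_cast; ring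
        _ ≤ _ := by
            rw [exp_le_exp]
            have hl2 : (n : ℝ) ≤ 100 * l := by exact_mod_cast hl.2
            have hl0 : (0:ℝ) ≤ l := by positivity
            nlinarith [mul_le_mul_of_nonneg_right hβ hl0]
    calc ((anim n l).card : ℝ) * (2 ^ (16 * l) * exp (-(β * l / 4)) * ZZ n β)
        ≤ (((n * n : ℕ) : ℝ) * 2 ^ (9 * l)) * (2 ^ (16 * l) * exp (-(β * l / 4)) * ZZ n β) :=
          mul_le_mul_of_nonneg_right h4 (by positivity)
      _ = ((n * n : ℕ) : ℝ) * (2 ^ (9 * l) * (2 ^ (16 * l) * exp (-(β * l / 4)))) * ZZ n β := by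
          ring
      _ ≤ _ := mul_le_mul_of_nonneg_right (mul_le_mul_of_nonneg_left h5 (by positivity)) hZ
  refine (Finset.sum_le_card_nsmul _ _ _ h2).trans ?_
  rw [nsmul_eq_mul, mul_assoc, mul_assoc, mul_assoc]
  refine mul_le_mul_of_nonneg_right ?_ (by positivity)
  have : R.card ≤ n * n + 1 := by
    rw [hR]
    exact (Finset.card_filter_le _ _).trans (by simp)
  exact_mod_cast this

end peierls

section final

variable {n : ℕ}

theorem spinVal_abs (b : Bool) : |spinVal b| = 1 := by
  cases b <;> simp [spinVal]

theorem nbrSum_bound (σ : Fin n × Fin n → Bool) (v : Fin n × Fin n) :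
    |nbrSum (grid n) σ v| ≤ 9 := by
  unfold nbrSum
  refine (Finset.abs_sum_le_sum_abs _ _).trans ?_
  have h : ∀ u ∈ (Finset.univ : Finset (Fin n × Fin n)),
      |if (grid n).Adj v u then spinVal (σ u) else 0| ≤ if shr v u then (1:ℝ) else 0 := by
    intro u _
    by_cases ha : (grid n).Adj v u
    · have hs : shr v u := by
        rw [grid_adj] at ha
        unfold shr
        rcases ha with h | h | h | h <;>
        · have := congrArg Fin.val h.1
          omega
      rw [if_pos ha, if_pos hs, spinVal_abs]
    · rw [if_neg ha, abs_zero]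
      split_ifs <;> norm_num
  refine (Finset.sum_le_sum h).trans ?_
  rw [Finset.sum_boole]
  exact_mod_cast shr_card v

theorem weight_reset (β : ℝ) (hβ : 0 ≤ β) (σ : Fin n × Fin n → Bool) (v : Fin n × Fin n) :
    exp (β * ham (grid n) σ) ≤
      exp (18 * β) * exp (β * ham (grid n) (Function.update σ v false)) := by
  obtain ⟨C, hC⟩ := ham_update (grid n) σ v
  have h1 := hC (σ v)
  rw [Function.update_eq_self] at h1
  have h2 := hC false
  have hb := abs_le.1 (nbrSum_bound σ v)
  rw [← exp_add, exp_le_exp]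
  have h3 : ham (grid n) σ ≤ 18 + ham (grid n) (Function.update σ v false) := by
    rw [h1, h2]
    cases σ v <;> simp only [spinVal, if_true, if_false, Bool.false_eq_true] <;> linarith [hb.1, hb.2]
  nlinarith [mul_le_mul_of_nonneg_left h3 hβ]

theorem reset_step (β : ℝ) (hβ : 0 ≤ β) (S S' : Finset (Fin n × Fin n → Bool))
    (v : Fin n × Fin n) (hcl : ∀ σ ∈ S, Function.update σ v false ∈ S') :
    ∑ σ ∈ S, exp (β * ham (grid n) σ) ≤
      (2 * exp (18 * β)) * ∑ σ ∈ S', exp (β * ham (grid n) σ) := by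
  rw [← Finset.sum_fiberwise_of_maps_to hcl, Finset.mul_sum]
  refine Finset.sum_le_sum fun y _ => ?_
  have h1 : ∀ σ ∈ S.filter (fun σ => Function.update σ v false = y),
      exp (β * ham (grid n) σ) ≤ exp (18 * β) * exp (β * ham (grid n) y) := by
    intro σ hσ
    rw [Finset.mem_filter] at hσ
    have := weight_reset β hβ σ v
    rwa [hσ.2] at this
  refine (Finset.sum_le_card_nsmul _ _ _ h1).trans ?_
  have h2 : (S.filter (fun σ => Function.update σ v false = y)).card ≤ 2 := by
    refine (Finset.card_le_card (t := {Function.update y v true, Function.update y v false})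
      ?_).trans Finset.card_le_two
    intro σ hσ
    rw [Finset.mem_filter] at hσ
    have h3 : σ = Function.update y v (σ v) := by
      rw [← hσ.2, Function.update_idem, Function.update_eq_self]
    rw [Finset.mem_insert, Finset.mem_singleton]
    cases hv : σ v
    · right; rw [hv] at h3; exact h3
    · left; rw [hv] at h3; exact h3
  rw [nsmul_eq_mul, mul_assoc]
  exact mul_le_mul_of_nonneg_right (by exact_mod_cast h2) (by positivity)

theorem reset (β : ℝ) (hβ : 0 ≤ β) (A : Finset (Fin n × Fin n))
    (S : Finset (Fin n × Fin n → Bool))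
    (hcl : ∀ v ∈ A, ∀ σ ∈ S, Function.update σ v false ∈ S) :
    ∑ σ ∈ S, exp (β * ham (grid n) σ) ≤
      (2 * exp (18 * β)) ^ A.card *
        ∑ σ ∈ S.filter (fun σ => ∀ v ∈ A, σ v = false), exp (β * ham (grid n) σ) := by
  have key : ∀ T : Finset (Fin n × Fin n), T ⊆ A → ∑ σ ∈ S, exp (β * ham (grid n) σ) ≤
      (2 * exp (18 * β)) ^ T.card *
        ∑ σ ∈ S.filter (fun σ => ∀ v ∈ T, σ v = false), exp (β * ham (grid n) σ) := by
    intro T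
    induction T using Finset.induction_on with
    | empty => intro _; simp
    | insert v T hv ih =>
      intro hT
      refine (ih ((Finset.subset_insert _ _).trans hT)).trans ?_
      rw [Finset.card_insert_of_notMem hv, pow_succ, mul_assoc]
      refine mul_le_mul_of_nonneg_left ?_ (by positivity)
      refine reset_step β hβ _ _ v fun σ hσ => ?_
      rw [Finset.mem_filter] at hσ ⊢
      refine ⟨hcl v (hT (Finset.mem_insert_self _ _)) σ hσ.1, fun u hu => ?_⟩
      by_cases huv : u = v
      · subst huv; simp
      · rw [Function.update_of_ne huv]
        exact hσ.2 u ((Finset.mem_insert.1 hu).resolve_left huv)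
  exact key A (Finset.Subset.refl _)

theorem ham_gfl (σ : Fin n × Fin n → Bool) : ham (grid n) (gfl σ) = ham (grid n) σ := by
  unfold ham
  refine Finset.sum_congr rfl fun e _ => ?_
  induction e using Sym2.ind with
  | _ u v =>
    simp only [Sym2.lift_mk, gfl]
    cases σ u <;> cases σ v <;> simp [spinVal]

theorem gfl_gfl (σ : Fin n × Fin n → Bool) : gfl (gfl σ) = σ := by
  funext u; simp [gfl]

/-- phase class -/
def phcl (A : Finset (Fin n × Fin n)) (w : Fin n × Fin n) (s : ZMod 2) :
    Finset (Fin n × Fin n → Bool) :=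
  Finset.univ.filter (fun σ => Good A σ ∧ phs A σ w = s)

theorem mem_phcl (A : Finset (Fin n × Fin n)) (w : Fin n × Fin n) (s : ZMod 2)
    (σ : Fin n × Fin n → Bool) : σ ∈ phcl A w s ↔ Good A σ ∧ phs A σ w = s := by
  unfold phcl
  rw [Finset.mem_filter]
  exact ⟨fun h => h.2, fun h => ⟨Finset.mem_univ _, h⟩⟩

/-- bad set -/
def badS (A : Finset (Fin n × Fin n)) : Finset (Fin n × Fin n → Bool) :=
  Finset.univ.filter (fun σ => ¬ Good A σ)

theorem mem_badS (A : Finset (Fin n × Fin n)) (σ : Fin n × Fin n → Bool) :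
    σ ∈ badS A ↔ ¬ Good A σ := by
  unfold badS
  rw [Finset.mem_filter]
  exact ⟨fun h => h.2, fun h => ⟨Finset.mem_univ _, h⟩⟩

theorem zmod2_cases : ∀ s : ZMod 2, s = 0 ∨ s = 1 := by decide
theorem zmod2_add : ∀ s : ZMod 2, s + 1 + 1 = s := by decide

theorem phcl_gfl (β : ℝ) (A : Finset (Fin n × Fin n)) (w : Fin n × Fin n) (s : ZMod 2) :
    ∑ σ ∈ phcl A w (s + 1), exp (β * ham (grid n) σ) =
      ∑ σ ∈ phcl A w s, exp (β * ham (grid n) σ) := by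
  refine Finset.sum_nbij' gfl gfl ?_ ?_ ?_ ?_ ?_
  · intro σ h
    rw [mem_phcl] at h ⊢
    refine ⟨(Good_gfl A σ).2 h.1, ?_⟩
    rw [phs_gfl, h.2, zmod2_add]
  · intro σ h
    rw [mem_phcl] at h ⊢
    refine ⟨(Good_gfl A σ).2 h.1, ?_⟩
    rw [phs_gfl, h.2]
  · intro σ _; exact gfl_gfl σ
  · intro σ _; exact gfl_gfl σ
  · intro σ _; rw [ham_gfl]

theorem phcl_disj (A : Finset (Fin n × Fin n)) (w : Fin n × Fin n) :
    Disjoint (phcl A w 0) (phcl A w 1) := by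
  rw [Finset.disjoint_left]
  intro σ h h'
  rw [mem_phcl] at h h'
  have := h.2.symm.trans h'.2
  exact absurd this (by decide)

theorem phcl_cover (A : Finset (Fin n × Fin n)) (w : Fin n × Fin n) (σ : Fin n × Fin n → Bool) :
    σ ∈ (phcl A w 0 ∪ phcl A w 1) ∪ badS A := by
  rw [Finset.mem_union, Finset.mem_union, mem_phcl, mem_phcl, mem_badS]
  by_cases hg : Good A σ
  · left
    rcases zmod2_cases (phs A σ w) with h | h
    · left; exact ⟨hg, h⟩
    · right; exact ⟨hg, h⟩
  · right; exact hg

theorem phcl_weight (β : ℝ) (A : Finset (Fin n × Fin n)) (w : Fin n × Fin n)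
    (hL : ∑ σ ∈ badS A, exp (β * ham (grid n) σ) ≤ 1/2 * ZZ n β) (s : ZMod 2) :
    1/4 * ZZ n β ≤ ∑ σ ∈ phcl A w s, exp (β * ham (grid n) σ) := by
  have h1 : ZZ n β ≤ (∑ σ ∈ phcl A w 0, exp (β * ham (grid n) σ) +
      ∑ σ ∈ phcl A w 1, exp (β * ham (grid n) σ)) + ∑ σ ∈ badS A, exp (β * ham (grid n) σ) := by
    rw [← Finset.sum_union (phcl_disj A w)]
    have hd : Disjoint (phcl A w 0 ∪ phcl A w 1) (badS A) := by
      rw [Finset.disjoint_left]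
      intro σ h h'
      rw [Finset.mem_union, mem_phcl, mem_phcl] at h
      rw [mem_badS] at h'
      rcases h with h | h <;> exact h' h.1
    rw [← Finset.sum_union hd]
    unfold ZZ
    refine Finset.sum_le_sum_of_subset_of_nonneg (fun σ _ => phcl_cover A w σ)
      fun σ _ _ => (exp_pos _).le
  have h2 := phcl_gfl β A w 0
  rw [zero_add] at h2
  rcases zmod2_cases s with rfl | rfl <;> linarith

theorem condIsing_mass (β : ℝ) (A : Finset (Fin n × Fin n)) (S : Finset (Fin n × Fin n → Bool)) :
    ∑ σ ∈ S, condIsing (grid n) β A false σ =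
      (∑ σ ∈ S.filter (fun σ => ∀ v ∈ A, σ v = false), exp (β * ham (grid n) σ)) /
        condZ (grid n) β A false := by
  rw [Finset.sum_filter, Finset.sum_div]
  refine Finset.sum_congr rfl fun σ _ => ?_
  unfold condIsing
  by_cases h : ∀ v ∈ A, σ v = false
  · rw [if_pos h, if_pos h]
  · rw [if_neg h, if_neg h, zero_div]

theorem core (hn : 3 ≤ n) (β : ℝ) (hβ : 104 ≤ β) (A : Finset (Fin n × Fin n))
    (hA : 800 * A.card ≤ n) (Q : ℝ)
    (hQ : ((n * n + 1 : ℕ) : ℝ) * ((n * n : ℕ) : ℝ) * exp (-(n / 100 : ℝ)) = Q)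
    (hQ2 : Q ≤ 1/2) (t : ℕ)
    (ht : ∀ σ, tvDist (evolve (pinnedK (grid n) β A false) t (delta σ))
      (condIsing (grid n) β A false) ≤ 1/4) :
    1/16 ≤ t * ((2 * exp (18 * β)) ^ A.card * Q) := by
  have w : Fin n × Fin n := (⟨0, by omega⟩, ⟨0, by omega⟩)
  haveI : Nonempty (Fin n × Fin n) := ⟨w⟩
  have hβ0 : 0 ≤ β := by linarith
  have hZ : 0 < ZZ n β := Finset.sum_pos (fun σ _ => exp_pos _) ⟨fun _ => true, Finset.mem_univ _⟩
  have hcZ := condZ_pos (grid n) β A false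
  have hbad : ∑ σ ∈ badS A, exp (β * ham (grid n) σ) ≤ Q * ZZ n β := by
    have := peierls β hβ A hA
    rw [hQ] at this
    exact this
  have hw := phcl_weight β A w (hbad.trans (mul_le_mul_of_nonneg_right hQ2 hZ.le))
  have hone : ∑ σ ∈ phcl A w 0, condIsing (grid n) β A false σ +
      ∑ σ ∈ phcl A w 1, condIsing (grid n) β A false σ ≤ 1 := by
    rw [← Finset.sum_union (phcl_disj A w), ← condIsing_sum (grid n) β A false]
    exact Finset.sum_le_sum_of_subset_of_nonneg (Finset.subset_univ _)
      fun σ _ _ => condIsing_nonneg _ _ _ _ _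
  obtain ⟨s, hs⟩ : ∃ s, ∑ σ ∈ phcl A w s, condIsing (grid n) β A false σ ≤ 1/2 := by
    by_contra hc
    push Not at hc
    linarith [hc 0, hc 1]
  have hagu : ∀ (σ : Fin n × Fin n → Bool) v b, ∀ u, u ≠ v → σ u = Function.update σ v b u :=
    fun σ v b u hu => (Function.update_of_ne hu _ _).symm
  have hreset := reset β hβ0 A (phcl A w s) (by
    intro v hv σ hσ
    rw [mem_phcl] at hσ ⊢
    have hg := Good_of_mem A σ _ v hv (hagu σ v false) hσ.1
    exact ⟨hg, (phs_stable A σ _ v hn hσ.1 hg (hagu σ v false) w).symm.trans hσ.2⟩)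
  have hD : 0 < (2 * exp (18 * β)) ^ A.card := by positivity
  set D := (2 * exp (18 * β)) ^ A.card with hDd
  set WS := ∑ σ ∈ (phcl A w s).filter (fun σ => ∀ v ∈ A, σ v = false), exp (β * ham (grid n) σ)
    with hWS
  have h4 : 1/4 * ZZ n β ≤ D * WS := (hw s).trans hreset
  have hWSpos : 0 < WS := by
    by_contra hc
    push Not at hc
    nlinarith [mul_nonneg hD.le (neg_nonneg.2 hc)]
  have hmS : ∑ σ ∈ phcl A w s, condIsing (grid n) β A false σ = WS / condZ (grid n) β A false :=
    condIsing_mass β A _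
  have hmL : ∑ σ ∈ badS A, condIsing (grid n) β A false σ ≤
      Q * ZZ n β / condZ (grid n) β A false := by
    rw [condIsing_mass]
    refine div_le_div_of_nonneg_right (le_trans ?_ hbad) hcZ.le
    exact Finset.sum_le_sum_of_subset_of_nonneg (Finset.filter_subset _ _)
      fun σ _ _ => (exp_pos _).le
  have hb := bottleneck (pinnedK (grid n) β A false) (condIsing (grid n) β A false)
    (pinnedK_nonneg _ _ _ _) (pinnedK_sum _ _ _ _) (pinned_stat _ _ _ _)
    (condIsing_nonneg _ _ _ _) (condIsing_sum _ _ _ _) (phcl A w s) (badS A)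
    (by rw [hmS]; positivity) hs (by
      intro σ hσ σ' hK
      obtain ⟨v, b, rfl⟩ := pinned_support _ _ _ _ _ _ hK
      rw [mem_phcl] at hσ
      by_cases hg : Good A (Function.update σ v b)
      · left
        rw [mem_phcl]
        exact ⟨hg, (phs_stable A σ _ v hn hσ.1 hg (hagu σ v b) w).symm.trans hσ.2⟩
      · right
        rw [mem_badS]; exact hg) t ht
  rw [hmS] at hb
  have h5 : 1/4 * WS ≤ t * (Q * ZZ n β) := by
    have h6 := hb.trans (mul_le_mul_of_nonneg_left hmL (Nat.cast_nonneg t))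
    rw [← mul_div_assoc, ← mul_div_assoc, div_le_div_iff_of_pos_right hcZ] at h6
    exact h6
  have h7 : 1/16 * ZZ n β ≤ (t * (D * Q)) * ZZ n β := by
    have h8 := mul_le_mul_of_nonneg_left h5 hD.le
    nlinarith
  exact le_of_mul_le_mul_right h7 hZ

theorem numer : ∃ n₀ : ℕ, ∀ n : ℕ, n₀ ≤ n →
    ((n * n + 1 : ℕ) : ℝ) * ((n * n : ℕ) : ℝ) * exp (-(n / 100 : ℝ)) ≤
      1/16 * exp (-(n / 200 : ℝ)) := by
  have h1 := (Real.tendsto_pow_mul_exp_neg_atTop_nhds_zero 4)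
  have h2 : Filter.Tendsto (fun n : ℕ => (n : ℝ) / 200) Filter.atTop Filter.atTop :=
    tendsto_natCast_atTop_atTop.atTop_div_const (by norm_num)
  have h3 := h1.comp h2
  have h4 := (h3.eventually (gt_mem_nhds (show (0:ℝ) < 1 / (32 * 200 ^ 4) by norm_num)))
  obtain ⟨n₀, hn₀⟩ := Filter.eventually_atTop.1 h4
  refine ⟨n₀ + 1, fun n hn => ?_⟩
  have h5 := hn₀ n (by omega)
  simp only [Function.comp] at h5
  have hn1 : (1:ℝ) ≤ n := by exact_mod_cast (by omega : 1 ≤ n)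
  have he : exp (-(n / 100 : ℝ)) = exp (-(n / 200 : ℝ)) * exp (-(n / 200 : ℝ)) := by
    rw [← exp_add]; congr 1; ring
  rw [he, ← mul_assoc]
  refine mul_le_mul_of_nonneg_right ?_ (exp_pos _).le
  have h6 : ((n * n + 1 : ℕ) : ℝ) * ((n * n : ℕ) : ℝ) ≤ 2 * (n:ℝ)^4 := by
    push_cast
    nlinarith [sq_nonneg ((n:ℝ)), mul_le_mul hn1 hn1 (by norm_num) (by linarith), pow_le_pow_right₀ hn1 (show 2 ≤ 4 by norm_num)]
  refine (mul_le_mul_of_nonneg_right h6 (exp_pos _).le).trans ?_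
  have h7 : ((n:ℝ)/200)^4 * exp (-((n:ℝ)/200)) = (n:ℝ)^4 * exp (-((n:ℝ)/200)) / 200^4 := by
    rw [div_pow]; ring
  rw [h7, div_lt_div_iff₀ (by norm_num) (by norm_num)] at h5
  nlinarith

end final

/-- **Sublinear corruption cannot flip the grid quickly.** For `β` a sufficiently large
constant there is `c = c(β) > 0` such that for every `γ ∈ (0, c)` there are `δ > 0` and
`n₀` with: for all `n ≥ n₀` and every `A ⊆ [n]²` with `|A| ≤ δn`, the `A`-corrupted
Glauber dynamics on the `n × n` grid with `A` pinned to `−1` has mixing time at least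
`exp((c − γ)n)`. -/
theorem grid_sublinear_corruption_slow_mixing :
    ∃ β₀ : ℝ, ∀ β : ℝ, β₀ ≤ β → ∃ c : ℝ, 0 < c ∧
      ∀ γ : ℝ, 0 < γ → γ < c → ∃ δ : ℝ, 0 < δ ∧ ∃ n₀ : ℕ, ∀ n : ℕ, n₀ ≤ n →
        ∀ A : Finset (Fin n × Fin n), (A.card : ℝ) ≤ δ * n →
          exp ((c - γ) * n)
            ≤ (mixingTime (pinnedK (grid n) β A false) (condIsing (grid n) β A false) : ℝ) := by

  refine ⟨104, fun β hβ => ⟨1/400, by norm_num, fun γ hγ hγc => ?_⟩⟩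
  have hB : 0 < 1 + 18 * β := by linarith
  obtain ⟨n₀, hn₀⟩ := numer
  refine ⟨1 / (800 * (1 + 18 * β)), by positivity, n₀ + 3, fun n hn A hA => ?_⟩
  have hn3 : 3 ≤ n := by omega
  haveI : Nonempty (Fin n × Fin n) := ⟨(⟨0, by omega⟩, ⟨0, by omega⟩)⟩
  have hnn : (0:ℝ) ≤ n := Nat.cast_nonneg n
  have hA1 : (A.card : ℝ) * (800 * (1 + 18 * β)) ≤ n := by
    rw [div_mul_eq_mul_div, one_mul, le_div_iff₀ (by positivity)] at hA
    exact hA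
  have hc0 : (0:ℝ) ≤ A.card := Nat.cast_nonneg _
  have hA2 : 800 * A.card ≤ n := by
    have : (800:ℝ) * A.card ≤ n := by nlinarith
    exact_mod_cast this
  have hq := hn₀ n (by omega)
  have hq2 : (1/16 : ℝ) * exp (-(n / 200 : ℝ)) ≤ 1/2 := by
    have : exp (-(n / 200 : ℝ)) ≤ 1 := by
      rw [exp_le_one_iff]
      have : (0:ℝ) ≤ n / 200 := by positivity
      linarith
    linarith
  have hmem := Nat.sInf_mem (s := {t : ℕ | ∀ σ₀ : Fin n × Fin n → Bool,
    tvDist (evolve (pinnedK (grid n) β A false) t (delta σ₀)) (condIsing (grid n) β A false) ≤ 1/4})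
    (pinned_mix (grid n) β A)
  change ∀ σ₀ : Fin n × Fin n → Bool, tvDist (evolve (pinnedK (grid n) β A false)
    (mixingTime (pinnedK (grid n) β A false) (condIsing (grid n) β A false)) (delta σ₀))
    (condIsing (grid n) β A false) ≤ 1/4 at hmem
  generalize mixingTime (pinnedK (grid n) β A false) (condIsing (grid n) β A false) = t at hmem ⊢
  have hcore := core hn3 β hβ A hA2 _ rfl (hq.trans hq2) t hmem
  have hD : (2 * exp (18 * β)) ^ A.card ≤ exp (n / 400 : ℝ) := by
    have h2e : (2:ℝ) ≤ exp 1 := by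
      have := add_one_le_exp (1:ℝ)
      linarith
    calc (2 * exp (18 * β)) ^ A.card ≤ (exp 1 * exp (18 * β)) ^ A.card :=
          pow_le_pow_left₀ (by positivity) (mul_le_mul_of_nonneg_right h2e (exp_pos _).le) _
      _ = exp (A.card * (1 + 18 * β)) := by rw [← exp_add, ← exp_nat_mul]
      _ ≤ _ := by
          rw [exp_le_exp]
          linarith
  have h1 : (1/16 : ℝ) ≤ t * (exp (n / 400 : ℝ) * (1/16 * exp (-(n / 200 : ℝ)))) := by
    refine hcore.trans (mul_le_mul_of_nonneg_left ?_ (Nat.cast_nonneg _))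
    exact mul_le_mul hD hq (by positivity) (exp_pos _).le
  have h2 : exp (n / 400 : ℝ) * (1/16 * exp (-(n / 200 : ℝ))) = 1/16 * exp (-(n / 400 : ℝ)) := by
    rw [mul_left_comm, ← exp_add]
    congr 2
    ring
  rw [h2, exp_neg] at h1
  have h3 : exp (n / 400 : ℝ) ≤ t := by
    have hp := exp_pos (n / 400 : ℝ)
    have h4 := mul_le_mul_of_nonneg_right h1 hp.le
    have h5 : (t:ℝ) * (1 / 16 * (exp (n / 400 : ℝ))⁻¹) * exp (n / 400 : ℝ) = 1/16 * t := by
      field_simp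
    linarith
  refine le_trans ?_ h3
  rw [exp_le_exp]
  nlinarith [mul_nonneg hγ.le hnn]

end
end
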